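/- Every quitting game admits a sunspot ε-equilibrium for every ε > 0: for every finite player set I = {1,…,N}, every family of payoff vectors r^S ∈ [−1,1]^N (S ⊆ I) satisfying r^i_i = 0 for every i ∈ I, and every ε > 0, there exists a sunspot strategy profile ξ of the quitting game that is a sunspot ε-equilibrium. -/

import Mathlib

open MeasureTheory

noncomputable section

/-- A sunspot strategy of a player: at stage `t` (0-indexed) the player has observed the
`t+1` public signals `s^1,…,s^{t+1}`, and quits with probability `ξ t (s^1,…,s^{t+1})`. -/
abbrev SunspotStrategy := (t : ℕ) → (Fin (t + 1) → ℝ) → ℝ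

/-- A sunspot strategy is valid if every stage-function is Borel measurable with values
in `[0,1]`. -/
def ValidSunspotStrategy (ξ : SunspotStrategy) : Prop :=
  ∀ t : ℕ, Measurable (ξ t) ∧ ∀ s, ξ t s ∈ Set.Icc (0 : ℝ) 1

/-- The product of `t` independent uniform measures on `[0,1]`. -/
def signalMeasure (t : ℕ) : Measure (Fin t → ℝ) :=
  Measure.pi fun _ => volume.restrict (Set.Icc 0 1)

/-- The probability that, under the sunspot strategy profile `ξ`, the game terminates at
stage `t` (0-indexed) with quitting set `S`. -/
def sunspotTermProb {N : ℕ} (ξ : Fin N → SunspotStrategy) (t : ℕ)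
    (S : Finset (Fin N)) : ℝ :=
  ∫ s : Fin (t + 1) → ℝ,
      (∏ u : Fin t, ∏ i : Fin N,
        (1 - ξ i u.1 fun k => s (Fin.castLE (Nat.succ_le_succ u.2.le) k))) *
      ((∏ i ∈ S, ξ i t s) * ∏ i ∈ Sᶜ, (1 - ξ i t s)) ∂(signalMeasure (t + 1))

/-- The collection of nonempty subsets of players. -/
def nonempties (N : ℕ) : Finset (Finset (Fin N)) :=
  Finset.univ.filter fun S => S ≠ ∅

/-- The expected payoff of player `i` under the sunspot strategy profile `ξ` in the
quitting game with payoffs `r`. -/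
def sunspotPayoff {N : ℕ} (r : Finset (Fin N) → Fin N → ℝ)
    (ξ : Fin N → SunspotStrategy) (i : Fin N) : ℝ :=
  (∑' t : ℕ, ∑ S ∈ nonempties N, sunspotTermProb ξ t S * r S i) +
    (1 - ∑' t : ℕ, ∑ S ∈ nonempties N, sunspotTermProb ξ t S) * r ∅ i

/-- `ξ` is a sunspot `ε`-equilibrium: it is a valid profile and no player can gain more
than `ε` by a unilateral deviation to any valid sunspot strategy. -/
def IsSunspotEpsEquilibrium {N : ℕ} (r : Finset (Fin N) → Fin N → ℝ)
    (ξ : Fin N → SunspotStrategy) (ε : ℝ) : Prop :=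
  (∀ i, ValidSunspotStrategy (ξ i)) ∧
    ∀ (i : Fin N) (ξ' : SunspotStrategy), ValidSunspotStrategy ξ' →
      sunspotPayoff r ξ i ≥ sunspotPayoff r (Function.update ξ i ξ') i - ε

section LCP
variable {ι : Type*} [Fintype ι]

/-- action of the matrix -/
def mulR (R : ι → ι → ℝ) (z : ι → ℝ) (j : ι) : ℝ := ∑ i, z i * R i j

structure LCPsol (R : ι → ι → ℝ) (Z : Finset ι) (q z : ι → ℝ) : Prop where
  nonneg : ∀ i, 0 ≤ z i
  supp : ∀ i, i ∉ Z → z i = 0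
  feas : ∀ j ∈ Z, 0 ≤ q j + mulR R z j
  compl : ∀ j ∈ Z, z j * (q j + mulR R z j) = 0

def IsQ (R : ι → ι → ℝ) (Z : Finset ι) : Prop := ∀ q : ι → ℝ, ∃ z, LCPsol R Z q z

inductive Reach (R : ι → ι → ℝ) (Z : Finset ι) (v0 : ι → ℝ) : (ι → ℝ) → ℝ → ℝ → Prop
  | refl : Reach R Z v0 v0 0 0
  | step {v : ι → ℝ} {m e : ℝ} (h : Reach R Z v0 v m e) (q z : ι → ℝ) (δ : ℝ)
      (hq : ∀ j, |q j - v j| ≤ δ) (hz : LCPsol R Z q z) (hpos : 0 < ∑ i, z i) :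
      Reach R Z v0 (fun j => q j + mulR R z j) (m + ∑ i, z i) (e + δ)

variable {R : ι → ι → ℝ} {Z : Finset ι}

lemma mulR_smul (t : ℝ) (z : ι → ℝ) (j : ι) : mulR R (fun i => t * z i) j = t * mulR R z j := by
  simp only [mulR, Finset.mul_sum, mul_assoc]

lemma mulR_add (z z' : ι → ℝ) (j : ι) :
    mulR R (fun i => z i + z' i) j = mulR R z j + mulR R z' j := by
  simp only [mulR, add_mul, Finset.sum_add_distrib]

lemma abs_mulR_le (hR : ∀ i j, |R i j| ≤ 1) {z : ι → ℝ} (hz : ∀ i, 0 ≤ z i) (j : ι) :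
    |mulR R z j| ≤ ∑ i, z i := by
  refine (Finset.abs_sum_le_sum_abs _ _).trans (Finset.sum_le_sum fun i _ => ?_)
  rw [abs_mul, abs_of_nonneg (hz i)]
  exact mul_le_of_le_one_right (hz i) (hR i j)

lemma LCPsol.scale {q z : ι → ℝ} (h : LCPsol R Z q z) {t : ℝ} (ht : 0 ≤ t) :
    LCPsol R Z (fun j => t * q j) (fun j => t * z j) := by
  refine ⟨fun i => mul_nonneg ht (h.nonneg i), fun i hi => by simp [h.supp i hi], fun j hj => ?_,
    fun j hj => ?_⟩
  · rw [mulR_smul, ← mul_add]; exact mul_nonneg ht (h.feas j hj)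
  · rw [mulR_smul, ← mul_add]
    have := h.compl j hj
    calc _ = t * t * (z j * (q j + mulR R z j)) := by ring
      _ = 0 := by rw [this, mul_zero]

namespace Reach
variable {v0 v : ι → ℝ} {m e : ℝ}

lemma mass_nonneg (h : Reach R Z v0 v m e) : 0 ≤ m := by
  induction h with
  | refl => exact le_rfl
  | step h q z δ hq hz hpos ih => linarith

lemma err_nonneg [Nonempty ι] (h : Reach R Z v0 v m e) : 0 ≤ e := by
  induction h with
  | refl => exact le_rfl
  | step h q z δ hq hz hpos ih =>
    have := (abs_nonneg _).trans (hq (Classical.arbitrary ι)); linarith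

/-- total displacement -/
lemma total (h : Reach R Z v0 v m e) : ∃ z : ι → ℝ, (∀ i, 0 ≤ z i) ∧ (∀ i, i ∉ Z → z i = 0) ∧
    ∑ i, z i = m ∧ ∀ j, |v j - (v0 j + mulR R z j)| ≤ e := by
  induction h with
  | refl => exact ⟨fun _ => 0, by simp, by simp, by simp, by simp [mulR]⟩
  | step h q z δ hq hz hpos ih =>
    obtain ⟨y, h1, h2, h3, h4⟩ := ih
    refine ⟨fun i => y i + z i, fun i => add_nonneg (h1 i) (hz.nonneg i), fun i hi => ?_, ?_, ?_⟩
    · simp [h2 i hi, hz.supp i hi]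
    · simp [Finset.sum_add_distrib, h3]
    · intro j
      rw [mulR_add]
      have a := abs_le.1 (h4 j)
      have b := abs_le.1 (hq j)
      rw [abs_le]; constructor <;> linarith [a.1, a.2, b.1, b.2]

lemma bdry (h : Reach R Z v0 v m e) (h0 : ∀ j ∈ Z, 0 ≤ v0 j) (h1 : ∃ j ∈ Z, v0 j = 0) :
    (∀ j ∈ Z, 0 ≤ v j) ∧ ∃ j ∈ Z, v j = 0 := by
  cases h with
  | refl => exact ⟨h0, h1⟩
  | step h q z δ hq hz hpos =>
    refine ⟨hz.feas, ?_⟩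
    obtain ⟨i, -, hi⟩ := Finset.exists_lt_of_sum_lt (f := fun _ : ι => (0 : ℝ)) (g := z)
      (s := Finset.univ) (by simpa using hpos)
    have hiZ : i ∈ Z := by
      by_contra hn; rw [hz.supp i hn] at hi; exact lt_irrefl _ hi
    refine ⟨i, hiZ, ?_⟩
    exact (mul_eq_zero.1 (hz.compl i hiZ)).resolve_left hi.ne'

lemma trans' {u w : ι → ℝ} {m' e' δ : ℝ} (h : Reach R Z v0 v m e) (hd : ∀ j, |v j - u j| ≤ δ)
    (h' : Reach R Z u w m' e') :
    m' = 0 ∨ Reach R Z v0 w (m + m') (e + e' + δ) := by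
  induction h' with
  | refl => exact Or.inl rfl
  | @step v' m' e' h' q z δ' hq hz hpos ih =>
    right
    cases h' with
    | refl =>
      have := Reach.step h q z (δ' + δ) (fun j => by
        have a := abs_le.1 (hd j)
        have b := abs_le.1 (hq j)
        rw [abs_le]; constructor <;> linarith [a.1, a.2, b.1, b.2]) hz hpos
      convert this using 1 <;> ring
    | step h'' q' z' δ'' hq' hz' hpos' =>
      rcases ih with ih | ih
      · exfalso; have := h''.mass_nonneg; linarith
      · have := Reach.step ih q z δ' hq hz hpos
        convert this using 1 <;> ring

lemma embed [Nonempty ι] (hR : ∀ i j, |R i j| ≤ 1) {Y : Finset ι} (hYZ : Y ⊆ Z) {u : ι → ℝ}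
    (h : Reach R Y (fun _ => 0) u m e) (vb : ι → ℝ) (β t : ℝ) (ht : 0 < t)
    (hβ : t * (m + e) ≤ β) (hv0 : ∀ j ∈ Y, vb j = 0) (hvβ : ∀ j ∈ Z, j ∉ Y → β ≤ vb j) :
    Reach R Z vb (fun j => vb j + t * u j) (t * m) (t * e) := by
  induction h with
  | refl => simpa using Reach.refl
  | @step v m e h q z δ hq hz hpos ih =>
    have hδ := (abs_nonneg _).trans (hq (Classical.arbitrary ι))
    have ih' := ih (by nlinarith)
    have hzs := hz.scale ht.le
    obtain ⟨y, y1, y2, y3, y4⟩ := h.total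
    have := Reach.step ih' (fun j => vb j + t * q j) (fun j => t * z j) (t * δ) (fun j => by
        have : vb j + t * q j - (vb j + t * v j) = t * (q j - v j) := by ring
        rw [this, abs_mul, abs_of_pos ht]
        exact mul_le_mul_of_nonneg_left (hq j) ht.le) ?_ (by
        rw [← Finset.mul_sum]; exact mul_pos ht hpos)
    · convert this using 1
      · funext j; rw [mulR_smul]; ring
      · rw [← Finset.mul_sum]; ring
      · ring
    · refine ⟨hzs.nonneg, fun i hi => hzs.supp i (fun h => hi (hYZ h)), fun j hj => ?_,
        fun j hj => ?_⟩
      · by_cases hjY : j ∈ Y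
        · simpa [hv0 j hjY] using hzs.feas j hjY
        · have a := hvβ j hj hjY
          rw [mulR_smul]
          have b := abs_le.1 (abs_mulR_le hR hz.nonneg j)
          have c := abs_le.1 (abs_mulR_le hR y1 j)
          have d := abs_le.1 (y4 j)
          have f := abs_le.1 (hq j)
          simp only [zero_add] at d
          have : -(m + ∑ i, z i + (e + δ)) ≤ q j + mulR R z j := by linarith [b.1, c.1, d.1, f.1]
          nlinarith
      · by_cases hjY : j ∈ Y
        · simpa [hv0 j hjY] using hzs.compl j hjY
        · simp [hz.supp j hjY]

end Reach

def TT (R : ι → ι → ℝ) (Z : Finset ι) : Prop :=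
  ∀ δ > 0, ∃ u m e, Reach R Z (fun _ => 0) u m e ∧ 0 < m ∧ e ≤ δ * m

/-- the local move -/
lemma local_move [Nonempty ι] (hR : ∀ i j, |R i j| ≤ 1) (hQ : IsQ R Z)
    (ih : ∀ Y, Y ⊂ Z → Y.Nonempty → IsQ R Y → TT R Y)
    (v : ι → ℝ) (hv : ∀ j ∈ Z, 0 ≤ v j) (h0 : ∃ j ∈ Z, v j = 0) (h1 : ∃ j ∈ Z, v j ≠ 0) :
    ∃ c > 0, ∀ δ > 0, ∃ v' m e, Reach R Z v v' m e ∧ c ≤ m ∧ e ≤ δ := by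
  classical
  set Y := Z.filter (fun j => v j = 0) with hY
  have hYZ : Y ⊂ Z := by
    refine (Finset.filter_subset _ _).ssubset_of_ne fun h => ?_
    obtain ⟨j, hj, hne⟩ := h1
    rw [← h] at hj
    exact hne (Finset.mem_filter.1 hj).2
  have hYn : Y.Nonempty := by
    obtain ⟨j, hj, he⟩ := h0; exact ⟨j, Finset.mem_filter.2 ⟨hj, he⟩⟩
  obtain ⟨β, hβ, hvβ⟩ : ∃ β > 0, ∀ j ∈ Z, j ∉ Y → β ≤ v j := by
    have hne : (Z \ Y).Nonempty := by
      obtain ⟨j, hj, hne⟩ := h1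
      exact ⟨j, by simp [hY, hj, hne]⟩
    obtain ⟨j0, hj0, hmin⟩ := Finset.exists_min_image (Z \ Y) v hne
    refine ⟨v j0, ?_, fun j hj hjY => hmin j (Finset.mem_sdiff.2 ⟨hj, hjY⟩)⟩
    obtain ⟨a, b⟩ := Finset.mem_sdiff.1 hj0
    refine lt_of_le_of_ne (hv j0 a) fun h => b (Finset.mem_filter.2 ⟨a, h.symm⟩)
  have hvY : ∀ j ∈ Y, v j = 0 := fun j hj => (Finset.mem_filter.1 hj).2
  by_cases hQY : IsQ R Y
  · have hT := ih Y hYZ hYn hQY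
    refine ⟨β / 2, by positivity, fun δ hδ => ?_⟩
    obtain ⟨u, m, e, hr, hm, he⟩ := hT (min 1 (δ / β)) (by positivity)
    have he1 : e ≤ m := he.trans (by nlinarith [min_le_left 1 (δ / β)])
    have he2 : e ≤ δ / β * m := he.trans (by nlinarith [min_le_right 1 (δ / β)])
    have he0 := hr.err_nonneg
    have := hr.embed hR hYZ.1 v β (β / (2 * m)) (by positivity) (by
      rw [div_mul_eq_mul_div, div_le_iff₀ (by positivity)]; nlinarith) hvY hvβ
    refine ⟨_, _, _, this, ?_, ?_⟩
    · apply le_of_eq; field_simp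
    · calc β / (2 * m) * e ≤ β / (2 * m) * (δ / β * m) := by gcongr
        _ = δ / 2 := by field_simp
        _ ≤ δ := by linarith
  · simp only [IsQ, not_forall] at hQY
    obtain ⟨d, hd⟩ := hQY
    push Not at hd
    set B := 1 + ∑ j, |d j| with hB
    have hdB : ∀ j, |d j| ≤ B := fun j => by
      have := Finset.single_le_sum (f := fun j => |d j|) (fun i _ => abs_nonneg _) (Finset.mem_univ j)
      linarith
    have hBpos : 0 < B := by
      have : 0 ≤ ∑ j, |d j| := Finset.sum_nonneg fun _ _ => abs_nonneg _
      linarith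
    refine ⟨β / 2, by positivity, fun δ' hδ' => ?_⟩
    set δ := min (δ' / B) (β / (4 * B)) with hδdef
    have hδ : 0 < δ := by positivity
    have hδ1 : δ * B ≤ δ' := by
      have := min_le_left (δ' / B) (β / (4 * B))
      rwa [← hδdef, le_div_iff₀ hBpos] at this
    have hδ2 : δ * B ≤ β / 4 := by
      have := min_le_right (δ' / B) (β / (4 * B))
      rw [← hδdef, le_div_iff₀ (by positivity)] at this; linarith
    obtain ⟨z, hz⟩ := hQ (fun j => v j + δ * d j)
    have hmass : β / 2 ≤ ∑ i, z i := by
      by_contra hlt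
      push Not at hlt
      have hz0 : ∀ j, j ∉ Y → z j = 0 := by
        intro j hj
        by_cases hjZ : j ∈ Z
        · have a := hvβ j hjZ hj
          have b := abs_le.1 (abs_mulR_le hR hz.nonneg j)
          have c := hz.compl j hjZ
          have c2 : |δ * d j| ≤ β / 4 := by
            rw [abs_mul, abs_of_pos hδ]
            exact (mul_le_mul_of_nonneg_left (hdB j) hδ.le).trans hδ2
          have c3 := abs_le.1 c2
          refine (mul_eq_zero.1 c).resolve_right (ne_of_gt ?_)
          linarith [b.1, c3.1]
        · exact hz.supp j hjZ
      have hs : LCPsol R Y (fun j => δ * d j) z := by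
        refine ⟨hz.nonneg, hz0, fun j hj => ?_, fun j hj => ?_⟩
        · simpa [hvY j hj] using hz.feas j (hYZ.1 hj)
        · simpa [hvY j hj] using hz.compl j (hYZ.1 hj)
      have hs' := hs.scale (t := δ⁻¹) (by positivity)
      refine hd _ (by simpa [inv_mul_cancel_left₀ hδ.ne'] using hs')
    refine ⟨_, _, _, Reach.step Reach.refl (fun j => v j + δ * d j) z (δ * B) (fun j => ?_) hz
      (by linarith), by linarith, by linarith⟩
    rw [add_sub_cancel_left, abs_mul, abs_of_pos hδ]
    exact mul_le_mul_of_nonneg_left (hdB j) hδ.le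

lemma bdd_of_reach (hR : ∀ i j, |R i j| ≤ 1) {v0 v : ι → ℝ} {m e : ℝ} (h : Reach R Z v0 v m e)
    (j : ι) : |v j| ≤ |v0 j| + m + e := by
  obtain ⟨z, h1, -, h3, h4⟩ := h.total
  have a := abs_le.1 (h4 j)
  have b := abs_le.1 (abs_mulR_le hR h1 j)
  have c := abs_le.1 (le_refl |v0 j|)
  rw [h3] at b
  rw [abs_le]; constructor <;> linarith [a.1, a.2, b.1, b.2, c.1, c.2]

lemma sup_lemma [Nonempty ι] (hR : ∀ i j, |R i j| ≤ 1) (hQ : IsQ R Z)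
    (ih : ∀ Y, Y ⊂ Z → Y.Nonempty → IsQ R Y → TT R Y)
    (v0 : ι → ℝ) (hv0 : ∀ j ∈ Z, 0 ≤ v0 j) (h0 : ∃ j ∈ Z, v0 j = 0) {M η : ℝ} (hM : 0 < M)
    (hη : 0 < η) :
    (∃ v m e, Reach R Z v0 v m e ∧ M ≤ m ∧ e ≤ 2 * η) ∨
    ∃ z : ι → ℝ, (∀ i, 0 ≤ z i) ∧ (∀ i, i ∉ Z → z i = 0) ∧ ∑ i, z i ≤ M ∧
      ∀ j ∈ Z, |v0 j + mulR R z j| ≤ 2 * η := by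
  classical
  by_contra hcon
  push Not at hcon
  obtain ⟨hA, hB⟩ := hcon
  set S : Set ℝ := {m | ∃ v e, Reach R Z v0 v m e ∧ e ≤ η * m / M ∧ m ≤ M} with hS
  have hSn : S.Nonempty := ⟨0, v0, 0, Reach.refl, by simp, hM.le⟩
  have hSb : BddAbove S := ⟨M, fun m ⟨v, e, h⟩ => h.2.2⟩
  obtain ⟨ms, -, hmst, hmsS⟩ := exists_seq_tendsto_sSup hSn hSb
  choose vs es hr he hm using hmsS
  have heη : ∀ n, es n ≤ η := fun n => (he n).trans (by
    rw [div_le_iff₀ hM]; exact mul_le_mul_of_nonneg_left (hm n) hη.le)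
  have hcomp : IsCompact (Set.pi Set.univ fun j : ι =>
      Set.Icc (-(|v0 j| + M + η)) (|v0 j| + M + η)) := isCompact_univ_pi fun _ => isCompact_Icc
  obtain ⟨vl, -, φ, hφ, hlim⟩ := hcomp.tendsto_subseq (x := vs) (fun n j _ => by
    have := bdd_of_reach hR (hr n) j
    have h2 := heη n
    have h3 := hm n
    exact abs_le.1 (by linarith))
  have hbd := fun n => (hr n).bdry hv0 h0
  have hlimj : ∀ j, Filter.Tendsto (fun n => vs (φ n) j) Filter.atTop (nhds (vl j)) := fun j =>
    (continuous_apply j).continuousAt.tendsto.comp hlim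
  have hvl0 : ∀ j ∈ Z, 0 ≤ vl j := fun j hj =>
    ge_of_tendsto' (hlimj j) fun n => (hbd (φ n)).1 j hj
  have hvlz : ∃ j ∈ Z, vl j = 0 := by
    have : ∏ j ∈ Z, vl j = 0 := by
      refine tendsto_nhds_unique (tendsto_finsetProd Z fun j _ => hlimj j) ?_
      have : (fun n => ∏ j ∈ Z, vs (φ n) j) = fun _ => 0 := by
        funext n
        obtain ⟨j, hj, hz⟩ := (hbd (φ n)).2
        exact Finset.prod_eq_zero hj hz
      rw [this]; exact tendsto_const_nhds
    exact Finset.prod_eq_zero_iff.1 this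
  have hclose : ∀ δ > 0, ∀ᶠ n in Filter.atTop, ∀ j, |vs (φ n) j - vl j| ≤ δ := by
    intro δ hδ
    rw [Filter.eventually_all]
    intro j
    filter_upwards [Metric.tendsto_nhds.1 (hlimj j) δ hδ] with n hn
    rw [Real.dist_eq] at hn; exact hn.le
  by_cases hall : ∀ j ∈ Z, vl j = 0
  · obtain ⟨n, hn⟩ := (hclose η hη).exists
    obtain ⟨z, h1, h2, h3, h4⟩ := (hr (φ n)).total
    obtain ⟨j, hj, hlt⟩ := hB z h1 h2 (h3 ▸ hm _)
    have a := abs_le.1 (hn j)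
    have b := abs_le.1 (h4 j)
    have c := heη (φ n)
    rw [hall j hj] at a
    refine absurd hlt (not_lt.2 ?_)
    rw [abs_le]; constructor <;> linarith [a.1, a.2, b.1, b.2]
  · push Not at hall
    obtain ⟨c, hc, hmove⟩ := local_move hR hQ ih vl hvl0 hvlz hall
    set δ := η * min c M / (4 * M) with hδd
    have hδ : 0 < δ := by positivity
    have hδc : 2 * δ ≤ η * c / M := by
      rw [hδd, le_div_iff₀ hM]
      field_simp
      nlinarith [min_le_left c M]
    have hδM : 2 * δ ≤ η := by
      rw [hδd]
      have : η * min c M / (4 * M) ≤ η * M / (4 * M) := by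
        gcongr; exact min_le_right _ _
      have h2 : η * M / (4 * M) = η / 4 := by field_simp
      linarith
    obtain ⟨v', m', e', hr', hcm, heδ⟩ := hmove δ hδ
    have hev : ∀ᶠ n in Filter.atTop, sSup S - c < ms (φ n) :=
      (hmst.comp hφ.tendsto_atTop).eventually_const_lt (by linarith)
    obtain ⟨n, hn1, hn2⟩ := ((hclose δ hδ).and hev).exists
    rcases (hr (φ n)).trans' hn1 hr' with h | h
    · linarith
    · have he1 := he (φ n)
      by_cases hle : ms (φ n) + m' ≤ M
      · have : ms (φ n) + m' ∈ S := by
          refine ⟨_, _, h, ?_, hle⟩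
          have : η * (ms (φ n) + m') / M = η * ms (φ n) / M + η * m' / M := by ring
          rw [this]
          have : η * c / M ≤ η * m' / M := by gcongr
          linarith
        have := le_csSup hSb this
        linarith
      · have := hA _ _ _ h (not_le.1 hle).le
        have := heη (φ n)
        linarith

def GG (R : ι → ι → ℝ) (Z : Finset ι) : Prop :=
  (∃ z, LCPsol R Z (fun _ => 0) z ∧ 0 < ∑ i, z i) ∨
  ∃ v0 : ι → ℝ, (∃ i ∈ Z, v0 i = 0 ∧ ∀ j, j ≠ i → 1 ≤ v0 j) ∧
    ∀ M > 0, ∀ η > 0, ∃ v m e, Reach R Z v0 v m e ∧ M ≤ m ∧ e ≤ η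

lemma TT_of_GG (h : GG R Z) : TT R Z := by
  intro δ hδ
  rcases h with ⟨z, hz, hpos⟩ | ⟨v0, -, h⟩
  · refine ⟨_, _, _, Reach.step Reach.refl (fun _ => 0) z 0 (by simp) hz hpos, by simpa, ?_⟩
    have := mul_pos hδ hpos
    simp; exact this.le
  · set K := ∑ j, |v0 j| with hK
    have hK0 : 0 ≤ K := Finset.sum_nonneg fun _ _ => abs_nonneg _
    obtain ⟨v, m, e, hr, hm, he⟩ := h ((K + 1) / δ) (by positivity) 1 one_pos
    have hmp : 0 < m := lt_of_lt_of_le (by positivity) hm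
    rcases (Reach.refl (R := R) (Z := Z) (v0 := fun _ => 0)).trans' (δ := K) (fun j => by
      rw [zero_sub, abs_neg]
      exact Finset.single_le_sum (f := fun j => |v0 j|) (fun i _ => abs_nonneg _)
        (Finset.mem_univ j)) hr with h0 | h0
    · exact absurd h0 hmp.ne'
    · refine ⟨_, _, _, h0, by simpa using hmp, ?_⟩
      rw [div_le_iff₀ hδ] at hm
      linarith

lemma mulR_sum {κ : Type*} (s : Finset κ) (f : κ → ι → ℝ) (j : ι) :
    mulR R (fun i => ∑ k ∈ s, f k i) j = ∑ k ∈ s, mulR R (f k) j := by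
  simp only [mulR, Finset.sum_mul]
  exact Finset.sum_comm

lemma GG_of_IsQ [Nonempty ι] (hR : ∀ i j, |R i j| ≤ 1) (hd : ∀ i, R i i = 0) :
    ∀ Z : Finset ι, Z.Nonempty → IsQ R Z → GG R Z := by
  classical
  intro Z
  induction Z using Finset.strongInduction with
  | H Z IH =>
  intro hZ hQ
  have ih : ∀ Y, Y ⊂ Z → Y.Nonempty → IsQ R Y → TT R Y := fun Y h1 h2 h3 =>
    TT_of_GG (IH Y h1 h2 h3)
  by_contra hG
  unfold GG at hG
  push Not at hG
  obtain ⟨hG1, hG2⟩ := hG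
  obtain ⟨zp, hzp⟩ := hQ (fun _ => -1)
  have hρ : ∀ j ∈ Z, 1 ≤ mulR R zp j := fun j hj => by have := hzp.feas j hj; linarith
  let w : ι → ι → ℝ := fun i j => if j ∈ Z then (if j = i then 0 else mulR R zp j) else 1
  have key : ∀ i ∈ Z, ∃ z : ι → ℝ, (∀ k, 0 ≤ z k) ∧ (∀ k, k ∉ Z → z k = 0) ∧
      ∀ j ∈ Z, w i j + mulR R z j = 0 := by
    intro i hi
    have hw0 : ∀ j ∈ Z, 0 ≤ w i j := by
      intro j hj
      simp only [w, hj, if_true]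
      split_ifs
      · exact le_rfl
      · linarith [hρ j hj]
    have hwz : ∃ j ∈ Z, w i j = 0 := ⟨i, hi, by simp [w, hi]⟩
    obtain ⟨M, hM, η, hη, hno⟩ := hG2 (w i) ⟨i, hi, by simp [w, hi], fun j hj => by
      by_cases hjZ : j ∈ Z
      · simpa [w, hj, hjZ] using hρ j hjZ
      · simp [w, hjZ]⟩
    have hcomp : IsCompact ((Set.pi Set.univ fun j : ι => Set.Icc (0:ℝ) M) ∩
        {z : ι → ℝ | ∀ k, k ∉ Z → z k = 0}) := by
      refine (isCompact_univ_pi fun _ => isCompact_Icc).inter_right ?_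
      simp only [Set.ofPred_forall]
      exact isClosed_iInter fun k => isClosed_iInter fun _ =>
        isClosed_eq (continuous_apply k) continuous_const
    have hcont : Continuous fun z : ι → ℝ => ∑ j ∈ Z, |w i j + mulR R z j| := by
      unfold mulR; fun_prop
    obtain ⟨z, ⟨hz1, hz2⟩, hmin⟩ := hcomp.exists_isMinOn ⟨fun _ => 0, by
      refine ⟨fun j _ => ⟨le_rfl, hM.le⟩, fun _ _ => rfl⟩⟩ hcont.continuousOn
    have hle : ∑ j ∈ Z, |w i j + mulR R z j| ≤ 0 := by
      refine le_of_forall_pos_le_add fun τ hτ => ?_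
      have hZc : (0:ℝ) < Z.card := by exact_mod_cast hZ.card_pos
      set η' := min (η / 2) (τ / (2 * Z.card)) with hη'
      have hη'p : 0 < η' := by positivity
      have h1 : 2 * η' ≤ η := by have := min_le_left (η / 2) (τ / (2 * Z.card)); linarith
      have h2 : 2 * η' * Z.card ≤ τ := by
        have := min_le_right (η / 2) (τ / (2 * Z.card))
        rw [← hη', le_div_iff₀ (by positivity)] at this; linarith
      rcases sup_lemma hR hQ ih (w i) hw0 hwz hM hη'p with ⟨v, m, e, a, b, c⟩ | ⟨y, y1, y2, y3, y4⟩
      · exact absurd (hno v m e a b) (not_lt.2 (c.trans h1))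
      · have := hmin (a := y) ⟨fun j _ => ⟨y1 j, (Finset.single_le_sum (f := y)
          (fun i _ => y1 i) (Finset.mem_univ j)).trans y3⟩, y2⟩
        simp only [Set.mem_ofPred_eq] at this
        refine this.trans ?_
        refine (Finset.sum_le_card_nsmul Z _ _ y4).trans ?_
        rw [nsmul_eq_mul]; linarith
    have heq := (Finset.sum_eq_zero_iff_of_nonneg fun j _ => abs_nonneg _).1
      (le_antisymm hle (Finset.sum_nonneg fun j _ => abs_nonneg _))
    exact ⟨z, fun k => (hz1 k trivial).1, hz2, fun j hj => abs_eq_zero.1 (heq j hj)⟩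
  choose! y y1 y2 y3 using key
  obtain ⟨i0, hi0⟩ := hZ
  have hpos : 0 < ∑ i, zp i := by
    have := (le_abs_self _).trans (abs_mulR_le hR hzp.nonneg i0)
    linarith [hρ i0 hi0]
  have hcard : 2 ≤ Z.card := by
    by_contra hlt
    have hc1 : Z.card = 1 := by
      have : 0 < Z.card := Finset.card_pos.2 ⟨i0, hi0⟩
      omega
    obtain ⟨a, ha⟩ := Finset.card_eq_one.1 hc1
    have hai : i0 = a := by rw [ha] at hi0; simpa using hi0
    have h1 := hρ i0 hi0
    have h2 : mulR R zp i0 = 0 := by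
      refine Finset.sum_eq_zero fun k _ => ?_
      by_cases hk : k = i0
      · rw [hk, hd, mul_zero]
      · rw [hzp.supp k (by rw [ha, ← hai]; simpa using hk), zero_mul]
    linarith
  have hcR : (2:ℝ) ≤ Z.card := by exact_mod_cast hcard
  let zz : ι → ℝ := fun i => ((Z.card : ℝ) - 1) * zp i + ∑ k ∈ Z, y k i
  have hmul : ∀ j ∈ Z, mulR R zz j = 0 := by
    intro j hj
    simp only [zz]
    rw [mulR_add (z := fun i => ((Z.card : ℝ) - 1) * zp i), mulR_smul, mulR_sum]
    have h1 : ∑ k ∈ Z, mulR R (y k) j = - ∑ k ∈ Z, w k j := by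
      rw [← Finset.sum_neg_distrib]
      exact Finset.sum_congr rfl fun k hk => by linarith [y3 k hk j hj]
    have h2 : ∑ k ∈ Z, w k j = ((Z.card : ℝ) - 1) * mulR R zp j := by
      rw [← Finset.sum_erase_add _ _ hj]
      have : w j j = 0 := by simp [w, hj]
      rw [this, add_zero]
      rw [Finset.sum_congr rfl (g := fun _ => mulR R zp j) fun k hk => ?_]
      · rw [Finset.sum_const, Finset.card_erase_of_mem hj, nsmul_eq_mul,
          Nat.cast_sub (by omega), Nat.cast_one]
      · have := (Finset.mem_erase.1 hk).1
        simp [w, hj, Ne.symm this]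
    rw [h1, h2]; ring
  have hzz0 : ∀ i, 0 ≤ zz i := fun i => add_nonneg
    (mul_nonneg (by linarith) (hzp.nonneg i)) (Finset.sum_nonneg fun k hk => y1 k hk i)
  have hsol : LCPsol R Z (fun _ => 0) zz := by
    refine ⟨hzz0, fun i hi => ?_, fun j hj => ?_, fun j hj => ?_⟩
    · simp only [zz]
      rw [hzp.supp i hi, mul_zero, zero_add]
      exact Finset.sum_eq_zero fun k hk => y2 k hk i hi
    · simp [hmul j hj]
    · simp [hmul j hj]
  have := hG1 zz hsol
  have h3 : ∑ i, zp i ≤ ∑ i, zz i := by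
    refine Finset.sum_le_sum fun i _ => ?_
    have h4 : 0 ≤ ∑ k ∈ Z, y k i := Finset.sum_nonneg fun k hk => y1 k hk i
    have h5 := hzp.nonneg i
    simp only [zz]
    nlinarith
  linarith
end LCP

section Sperner

lemma parity_doors (A : Finset ℕ) (f : ℕ → ℕ) (D : ℕ) (hA : A.card = D + 1)
    (hf : ∀ a ∈ A, f a ≤ D) :
    ((A.filter (fun k => (A.erase k).image f = Finset.range D)).card : ZMod 2) =
      if A.image f = Finset.range (D + 1) then 1 else 0 := by
  classical
  split_ifs with h
  · have hinj : Set.InjOn f A := by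
      apply Finset.injOn_of_card_image_eq
      rw [h, Finset.card_range, hA]
    obtain ⟨k, hk, hfk⟩ : ∃ k ∈ A, f k = D := by
      have : D ∈ A.image f := by rw [h]; simp
      simpa using this
    have : A.filter (fun k => (A.erase k).image f = Finset.range D) = {k} := by
      ext j
      simp only [Finset.mem_filter, Finset.mem_singleton]
      constructor
      · rintro ⟨hj, hd⟩
        by_contra hne
        have : f k ∈ (A.erase j).image f :=
          Finset.mem_image_of_mem f (Finset.mem_erase.2 ⟨Ne.symm hne, hk⟩)
        rw [hd, hfk] at this
        simp at this
      · rintro rfl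
        refine ⟨hk, ?_⟩
        ext y
        simp only [Finset.mem_image, Finset.mem_erase, Finset.mem_range]
        constructor
        · rintro ⟨a, ⟨h1, h2⟩, rfl⟩
          have h3 := hf a h2
          have h4 : f a ≠ D := fun h5 => h1 (hinj h2 hk (h5.trans hfk.symm))
          omega
        · intro hy
          have : y ∈ A.image f := by rw [h]; simp; omega
          obtain ⟨a, ha, rfl⟩ := Finset.mem_image.1 this
          exact ⟨a, ⟨fun h5 => by subst h5; omega, ha⟩, rfl⟩
    rw [this]; simp
  · by_cases hex : ∃ k ∈ A, (A.erase k).image f = Finset.range D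
    · obtain ⟨k, hk, hd⟩ := hex
      have hinj : Set.InjOn f (A.erase k) := by
        apply Finset.injOn_of_card_image_eq
        rw [hd, Finset.card_range, Finset.card_erase_of_mem hk, hA]; rfl
      have hfk : f k < D := by
        have h1 := hf k hk
        by_contra hn
        apply h
        have : f k = D := by omega
        rw [← Finset.insert_erase hk, Finset.image_insert, hd, this, ← Finset.range_add_one]
      obtain ⟨k', hk', hff⟩ : ∃ k' ∈ A.erase k, f k' = f k := by
        have : f k ∈ (A.erase k).image f := by rw [hd]; simpa using hfk
        simpa using this
      have hne := (Finset.mem_erase.1 hk').1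
      have hk'A := (Finset.mem_erase.1 hk').2
      have : A.filter (fun k => (A.erase k).image f = Finset.range D) = {k, k'} := by
        ext j
        simp only [Finset.mem_filter, Finset.mem_singleton, Finset.mem_insert]
        constructor
        · rintro ⟨hj, hdj⟩
          by_contra hcon
          push Not at hcon
          have hjk : j ∈ A.erase k := Finset.mem_erase.2 ⟨hcon.1, hj⟩
          have : f j ∈ (A.erase j).image f := by
            rw [hdj, ← hd]; exact Finset.mem_image_of_mem f hjk
          obtain ⟨a, ha, hfa⟩ := Finset.mem_image.1 this
          obtain ⟨ha1, ha2⟩ := Finset.mem_erase.1 ha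
          by_cases hak : a = k
          · subst hak
            exact hcon.2 (hinj hjk hk' (hfa.symm.trans hff.symm))
          · exact ha1 (hinj (Finset.mem_erase.2 ⟨hak, ha2⟩) hjk hfa)
        · rintro (rfl | rfl)
          · exact ⟨hk, hd⟩
          · refine ⟨hk'A, ?_⟩
            rw [← hd]
            ext y
            simp only [Finset.mem_image, Finset.mem_erase]
            constructor
            · rintro ⟨a, ⟨h1, h2⟩, rfl⟩
              by_cases hak : a = k
              · exact ⟨j, ⟨hne, hk'A⟩, by rw [hff, hak]⟩
              · exact ⟨a, ⟨hak, h2⟩, rfl⟩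
            · rintro ⟨a, ⟨h1, h2⟩, rfl⟩
              by_cases hak : a = j
              · exact ⟨k, ⟨hne.symm, hk⟩, by rw [hak, hff]⟩
              · exact ⟨a, ⟨hak, h2⟩, rfl⟩
      rw [this, Finset.card_pair hne.symm]
      decide
    · rw [Finset.filter_false_of_mem]
      · simp
      · intro k hk hd; exact hex ⟨k, hk, hd⟩

variable {n d : ℕ}

abbrev KS (n : ℕ) := (Fin n → ℕ) × Equiv.Perm (Fin n)

def kv (σ : KS n) (k : ℕ) (i : Fin n) : ℕ := σ.1 i + if (σ.2⁻¹ i).val < k then 1 else 0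

def SS (n m d : ℕ) : Finset (KS n) :=
  ((Fintype.piFinset fun _ : Fin n => Finset.range m) ×ˢ Finset.univ).filter
    (fun σ => ∀ i : Fin n, d ≤ i.val → σ.1 i = 0 ∧ σ.2 i = i)

lemma mem_SS {m d : ℕ} {σ : KS n} : σ ∈ SS n m d ↔
    (∀ i, σ.1 i < m) ∧ ∀ i : Fin n, d ≤ i.val → σ.1 i = 0 ∧ σ.2 i = i := by
  simp [SS]

structure Lab (n m : ℕ) (l : (Fin n → ℕ) → ℕ) : Prop where
  le : ∀ v, l v ≤ n
  low : ∀ v i, v i = 0 → l v ≤ (i : Fin n).val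
  high : ∀ v i, v i = m → l v ≠ (i : Fin n).val

def TTs (m : ℕ) (l : (Fin n → ℕ) → ℕ) (d : ℕ) : Finset (KS n) :=
  (SS n m d).filter fun σ => (Finset.range (d + 1)).image (fun k => l (kv σ k)) = Finset.range (d + 1)

def doors (m : ℕ) (l : (Fin n → ℕ) → ℕ) (d : ℕ) : Finset (KS n × ℕ) :=
  (SS n m (d+1) ×ˢ Finset.range (d + 2)).filter fun x =>
    ((Finset.range (d + 2)).erase x.2).image (fun k => l (kv x.1 k)) = Finset.range (d + 1)

lemma inv_fix {m d : ℕ} {σ : KS n} (h : σ ∈ SS n m d) (i : Fin n) (hi : d ≤ i.val) : σ.2⁻¹ i = i := by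
  rw [Equiv.Perm.inv_eq_iff_eq]; exact ((mem_SS.1 h).2 i hi).2.symm

lemma lt_of_lt {m d : ℕ} {σ : KS n} (h : σ ∈ SS n m d) (i : Fin n) (hi : i.val < d) :
    (σ.2 i).val < d := by
  by_contra hn
  push Not at hn
  have := ((mem_SS.1 h).2 _ hn).2
  have := σ.2.injective this
  rw [this] at hn; omega

lemma inv_lt_of_lt {m d : ℕ} {σ : KS n} (h : σ ∈ SS n m d) (i : Fin n) (hi : i.val < d) :
    (σ.2⁻¹ i).val < d := by
  by_contra hn
  push Not at hn
  have := ((mem_SS.1 h).2 _ hn).2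
  have h3 : σ.2 (σ.2⁻¹ i) = i := σ.2.apply_symm_apply i
  rw [h3] at this
  rw [← this] at hn; omega

lemma lab_le {m d : ℕ} {l : (Fin n → ℕ) → ℕ} (hl : Lab n m l) (hd : d ≤ n) {σ : KS n}
    (h : σ ∈ SS n m d) {k : ℕ} (hk : k ≤ d) : l (kv σ k) ≤ d := by
  rcases hd.eq_or_lt with rfl | hlt
  · exact hl.le _
  · refine hl.low _ ⟨d, hlt⟩ ?_
    have h1 := ((mem_SS.1 h).2 ⟨d, hlt⟩ le_rfl).1
    have h2 := inv_fix h ⟨d, hlt⟩ le_rfl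
    simp only [kv, h1, h2]
    rw [if_neg (by simpa using hk)]

lemma doors_parity {m d : ℕ} {l : (Fin n → ℕ) → ℕ} (hl : Lab n m l) (hd : d + 1 ≤ n) :
    ((doors m l d).card : ZMod 2) = (TTs m l (d + 1)).card := by
  classical
  have h1 : (doors m l d).card = ∑ σ ∈ SS n m (d+1), ((Finset.range (d+2)).filter fun k =>
      ((Finset.range (d + 2)).erase k).image (fun k => l (kv σ k)) = Finset.range (d + 1)).card := by
    rw [doors, Finset.card_filter, Finset.sum_product]
    refine Finset.sum_congr rfl fun σ _ => ?_
    rw [Finset.card_filter]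
  rw [h1, TTs, Finset.card_filter]
  push_cast
  refine Finset.sum_congr rfl fun σ hσ => ?_
  rw [parity_doors _ _ (d+1) (by simp)]
  · intro a ha
    exact lab_le hl hd hσ (by simp at ha; omega)

def swk (n k : ℕ) : Equiv.Perm (Fin n) :=
  if h : k < n then Equiv.swap ⟨k - 1, by omega⟩ ⟨k, h⟩ else 1

lemma swk_mul_self (n k : ℕ) : swk n k * swk n k = 1 := by
  unfold swk; split_ifs <;> simp

lemma kv_swk (σ : KS n) {k j : ℕ} (hk : 0 < k) (hj : j ≠ k) :
    kv (σ.1, σ.2 * swk n k) j = kv σ j := by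
  funext i
  have h1 : (σ.2 * swk n k)⁻¹ i = swk n k (σ.2⁻¹ i) := by
    rw [mul_inv_rev, inv_eq_of_mul_eq_one_right (swk_mul_self n k)]; rfl
  simp only [kv]
  rw [h1]
  congr 1
  generalize σ.2⁻¹ i = x
  unfold swk
  split_ifs with h a b <;> try rfl
  all_goals exfalso
  all_goals
    first
    | (rw [Equiv.swap_apply_def] at a
       split_ifs at a with h1 h2
       · subst h1; simp at *; omega
       · subst h2; simp at *; omega
       · simp at *; omega)
    | (simp at *; omega)

lemma doors_mid {m d : ℕ} {l : (Fin n → ℕ) → ℕ} (hd : d + 1 ≤ n) :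
    (((doors m l d).filter fun x => 0 < x.2 ∧ x.2 ≤ d).card : ZMod 2) = 0 := by
  classical
  rw [Finset.card_eq_sum_ones]
  push_cast
  refine Finset.sum_involution (fun x _ => ((x.1.1, x.1.2 * swk n x.2), x.2)) ?_ ?_ ?_ ?_
  · intros; decide
  · rintro ⟨⟨p, π⟩, k⟩ hx - heq
    simp only [Finset.mem_filter] at hx
    simp only [Prod.mk.injEq, and_true, true_and] at heq
    have : swk n k = 1 := by simpa using heq
    have h2 : swk n k ⟨k, by omega⟩ = ⟨k, by omega⟩ := by rw [this]; rfl
    unfold swk at h2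
    rw [dif_pos (by omega), Equiv.swap_apply_right] at h2
    simp at h2
    omega
  · rintro ⟨⟨p, π⟩, k⟩ hx
    simp only [Finset.mem_filter, doors, Finset.mem_product] at hx ⊢
    obtain ⟨⟨⟨h1, h2⟩, h3⟩, h4, h5⟩ := hx
    refine ⟨⟨⟨?_, h2⟩, ?_⟩, h4, h5⟩
    · rw [mem_SS] at h1 ⊢
      refine ⟨h1.1, fun i hi => ⟨(h1.2 i hi).1, ?_⟩⟩
      have : swk n k i = i := by
        unfold swk
        rw [dif_pos (by omega)]
        apply Equiv.swap_apply_of_ne_of_ne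
        · intro h; rw [h] at hi; simp at hi; omega
        · intro h; rw [h] at hi; simp at hi; omega
      rw [Equiv.Perm.mul_apply, this]
      exact (h1.2 i hi).2
    · rw [← h3]
      refine Finset.image_congr fun j hj => ?_
      have hj' := (Finset.mem_erase.1 hj).1
      rw [kv_swk (p, π) h4 hj']
  · rintro ⟨⟨p, π⟩, k⟩ hx
    simp [mul_assoc, swk_mul_self]

/-- shift up -/
def upS (hd : d + 1 ≤ n) (σ : KS n) : KS n :=
  (fun i => σ.1 i + if (σ.2⁻¹ i).val = 0 then 1 else 0, σ.2 * Fin.cycleRange ⟨d, hd⟩)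

/-- shift down -/
def downS (hd : d + 1 ≤ n) (σ : KS n) : KS n :=
  (fun i => σ.1 i - if (σ.2⁻¹ i).val = d then 1 else 0, σ.2 * (Fin.cycleRange ⟨d, hd⟩)⁻¹)

lemma cyc_val (hd : d + 1 ≤ n) (x : Fin n) : (Fin.cycleRange ⟨d, hd⟩ x).val =
    if x.val < d then x.val + 1 else if x.val = d then 0 else x.val := by
  split_ifs with h1 h2
  · rw [Fin.coe_cycleRange_of_lt (by simpa [Fin.lt_def] using h1)]
  · rw [Fin.coe_cycleRange_of_le (by simp [Fin.le_def, h2]), if_pos (Fin.ext h2)]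
  · rw [Fin.cycleRange_of_gt (by rw [Fin.lt_def]; simp only; omega)]

lemma cyci_val (hd : d + 1 ≤ n) (x : Fin n) : ((Fin.cycleRange ⟨d, hd⟩)⁻¹ x).val =
    if x.val = 0 then d else if x.val ≤ d then x.val - 1 else x.val := by
  obtain ⟨y, rfl⟩ := (Fin.cycleRange ⟨d, hd⟩).surjective x
  have h3 : (Fin.cycleRange ⟨d, hd⟩)⁻¹ (Fin.cycleRange ⟨d, hd⟩ y) = y :=
    (Fin.cycleRange ⟨d, hd⟩).symm_apply_apply y
  rw [h3, cyc_val]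
  grind

lemma kv_up (hd : d + 1 ≤ n) (σ : KS n) {j : ℕ} (hj : j ≤ d) :
    kv (upS hd σ) j = kv σ (j + 1) := by
  funext i
  simp only [kv, upS, mul_inv_rev, Equiv.Perm.mul_apply]
  rw [cyci_val]
  split_ifs <;> omega

lemma down_up (hd : d + 1 ≤ n) (σ : KS n) : downS hd (upS hd σ) = σ := by
  simp only [downS, upS, mul_inv_rev, Equiv.Perm.mul_apply, cyci_val]
  ext i
  · simp only
    split_ifs <;> omega
  · simp

lemma up_down (hd : d + 1 ≤ n) (σ : KS n) (h : 0 < σ.1 (σ.2 ⟨d, hd⟩)) :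
    upS hd (downS hd σ) = σ := by
  simp only [downS, upS, mul_inv_rev, Equiv.Perm.mul_apply, inv_inv, cyc_val]
  ext i
  · simp only
    have : (σ.2⁻¹ i).val = d → 0 < σ.1 i := by
      intro h2
      have : σ.2⁻¹ i = ⟨d, hd⟩ := Fin.ext h2
      rw [Equiv.Perm.inv_eq_iff_eq] at this
      rwa [this]
    have h3 : (if (σ.2⁻¹ i).val < d then (σ.2⁻¹ i).val + 1
      else if (σ.2⁻¹ i).val = d then 0 else (σ.2⁻¹ i).val) = 0 ↔ (σ.2⁻¹ i).val = d := by
      grind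
    simp only [h3]
    split_ifs <;> omega
  · simp

lemma doors_shift {m d : ℕ} {l : (Fin n → ℕ) → ℕ} (hl : Lab n m l) (hd : d + 1 ≤ n) :
    ((doors m l d).filter fun x => x.2 = 0).card =
      ((doors m l d).filter fun x => x.2 = d + 1 ∧ x.1 ∉ SS n m d).card := by
  classical
  have hup : ∀ σ : KS n, (Finset.image (fun k => l (kv (upS hd σ) k))
      ((Finset.range (d + 2)).erase (d+1))) = (Finset.image (fun k => l (kv σ k))
      ((Finset.range (d + 2)).erase 0)) := by
    intro σ
    ext y
    simp only [Finset.mem_image, Finset.mem_erase, Finset.mem_range]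
    constructor
    · rintro ⟨a, ⟨h1, h2⟩, rfl⟩
      exact ⟨a + 1, ⟨by omega, by omega⟩, by rw [kv_up hd σ (by omega)]⟩
    · rintro ⟨a, ⟨h1, h2⟩, rfl⟩
      refine ⟨a - 1, ⟨by omega, by omega⟩, ?_⟩
      rw [kv_up hd σ (by omega), Nat.sub_add_cancel (by omega)]
  have hposl : ∀ σ ∈ SS n m (d+1), (Finset.image (fun k => l (kv σ k))
      ((Finset.range (d + 2)).erase (d+1))) = Finset.range (d+1) → σ ∉ SS n m d →
      0 < σ.1 (σ.2 ⟨d, hd⟩) := by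
    intro σ h0 h3 hns
    have h1 := mem_SS.1 h0
    by_contra hz
    have hz : σ.1 (σ.2 ⟨d, hd⟩) = 0 := by omega
    have hlt := lt_of_lt h0 ⟨d, hd⟩ (by simp)
    have : d ∈ Finset.range (d + 1) := by simp
    rw [← h3] at this
    obtain ⟨a, ha, hla⟩ := Finset.mem_image.1 this
    have ha0 := Finset.mem_erase.1 ha
    have ha1 := Finset.mem_range.1 ha0.2
    have hle := hl.low (kv σ a) (σ.2 ⟨d, hd⟩) (by
      have h4 : σ.2⁻¹ (σ.2 ⟨d, hd⟩) = ⟨d, hd⟩ := σ.2.symm_apply_apply _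
      simp only [kv]
      rw [h4, hz, if_neg (by simp only; omega)])
    have heq : σ.2 ⟨d, hd⟩ = ⟨d, hd⟩ := Fin.ext (by simp only; omega)
    apply hns
    rw [mem_SS]
    refine ⟨h1.1, fun i hi => ?_⟩
    by_cases hid : i.val = d
    · have : i = ⟨d, hd⟩ := Fin.ext hid
      rw [this]
      exact ⟨by rw [heq] at hz; exact hz, heq⟩
    · exact h1.2 i (by omega)
  refine Finset.card_nbij' (fun x => (upS hd x.1, d + 1)) (fun x => (downS hd x.1, 0)) ?_ ?_ ?_ ?_
  · rintro ⟨σ, k⟩ hx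
    simp only [Finset.coe_filter, Set.mem_ofPred_eq, doors, Finset.mem_filter,
      Finset.mem_product] at hx ⊢
    obtain ⟨⟨⟨h0, -⟩, h3⟩, rfl⟩ := hx
    have h1 := mem_SS.1 h0
    have hSS : upS hd σ ∈ SS n m (d + 1) := by
      rw [mem_SS]
      refine ⟨fun i => ?_, fun i hi => ⟨?_, ?_⟩⟩
      · simp only [upS]
        split_ifs with hi
        · by_contra hge
          have him := h1.1 i
          have hid : i.val < d + 1 := by
            have := lt_of_lt h0 (σ.2⁻¹ i) (by omega)
            have h4 : σ.2 (σ.2⁻¹ i) = i := σ.2.apply_symm_apply i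
            rwa [h4] at this
          have : i.val ∈ Finset.range (d + 1) := by simpa using hid
          rw [← h3] at this
          obtain ⟨a, ha, hla⟩ := Finset.mem_image.1 this
          have ha0 := (Finset.mem_erase.1 ha).1
          refine hl.high _ i ?_ hla
          simp only [kv]
          rw [if_pos (by omega)]; omega
        · simpa using h1.1 i
      · simp only [upS]
        rw [(h1.2 i hi).1, inv_fix h0 i hi, if_neg (by omega)]
      · simp only [upS, Equiv.Perm.mul_apply]
        have : Fin.cycleRange ⟨d, hd⟩ i = i := by
          apply Fin.ext; rw [cyc_val, if_neg (by omega), if_neg (by omega)]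
        rw [this]; exact (h1.2 i hi).2
    refine ⟨⟨⟨hSS, by simp⟩, by rw [hup]; exact h3⟩, trivial, fun hS => ?_⟩
    have h5 := (mem_SS.1 hS).2 ⟨d, hd⟩ le_rfl
    have h6 := inv_fix hS ⟨d, hd⟩ le_rfl
    simp only [upS, mul_inv_rev, Equiv.Perm.mul_apply] at h5 h6
    have h7 := congrArg Fin.val h6
    rw [cyci_val] at h7
    simp only at h7
    have h8 := h5.1
    have h9 := inv_lt_of_lt h0 ⟨d, hd⟩ (by simp)
    split_ifs at h7 h8 <;> omega
  · rintro ⟨σ, k⟩ hx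
    simp only [Finset.coe_filter, Set.mem_ofPred_eq, doors, Finset.mem_filter,
      Finset.mem_product] at hx ⊢
    obtain ⟨⟨⟨h0, -⟩, h3⟩, rfl, hns⟩ := hx
    have h1 := mem_SS.1 h0
    have hpos := hposl σ h0 h3 hns
    refine ⟨⟨⟨?_, by simp⟩, ?_⟩, trivial⟩
    · rw [mem_SS]
      refine ⟨fun i => ?_, fun i hi => ⟨?_, ?_⟩⟩
      · simp only [downS]
        have := h1.1 i
        omega
      · simp only [downS]
        rw [(h1.2 i hi).1]; omega
      · simp only [downS, Equiv.Perm.mul_apply]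
        have : (Fin.cycleRange ⟨d, hd⟩)⁻¹ i = i := by
          apply Fin.ext; rw [cyci_val, if_neg (by omega), if_neg (by omega)]
        rw [this]; exact (h1.2 i hi).2
    · rw [← hup, up_down hd σ hpos]; exact h3
  · rintro ⟨σ, k⟩ hx
    simp only [Finset.coe_filter, Set.mem_ofPred_eq] at hx
    simp [down_up, hx.2]
  · rintro ⟨σ, k⟩ hx
    simp only [Finset.coe_filter, Set.mem_ofPred_eq, doors, Finset.mem_filter,
      Finset.mem_product] at hx
    obtain ⟨⟨⟨h0, -⟩, h3⟩, rfl, hns⟩ := hx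
    simp [up_down hd σ (hposl σ h0 h3 hns)]

lemma doors_bdry {m d : ℕ} {l : (Fin n → ℕ) → ℕ} :
    ((doors m l d).filter fun x => x.2 = d + 1 ∧ x.1 ∈ SS n m d).card = (TTs m l d).card := by
  classical
  have he : (Finset.range (d + 2)).erase (d + 1) = Finset.range (d + 1) := by
    ext; simp; omega
  refine Finset.card_nbij' (fun x => x.1) (fun σ => (σ, d + 1)) ?_ ?_ ?_ ?_
  · rintro ⟨σ, k⟩ hx
    simp only [Finset.coe_filter, Set.mem_ofPred_eq, doors, Finset.mem_filter,
      Finset.mem_product, TTs] at hx ⊢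
    obtain ⟨⟨⟨h0, -⟩, h3⟩, rfl, hns⟩ := hx
    exact ⟨hns, by rw [he] at h3; exact h3⟩
  · intro σ hx
    simp only [Finset.coe_filter, Set.mem_ofPred_eq, doors, Finset.mem_filter,
      Finset.mem_product, TTs] at hx ⊢
    refine ⟨⟨⟨?_, by simp⟩, by rw [he]; exact hx.2⟩, trivial, hx.1⟩
    have := mem_SS.1 hx.1
    exact mem_SS.2 ⟨this.1, fun i hi => this.2 i (by omega)⟩
  · rintro ⟨σ, k⟩ hx
    simp only [Finset.coe_filter, Set.mem_ofPred_eq] at hx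
    simp [hx.2.1]
  · intro σ _; rfl

lemma doors_card {m d : ℕ} {l : (Fin n → ℕ) → ℕ} (hl : Lab n m l) (hd : d + 1 ≤ n) :
    ((doors m l d).card : ZMod 2) = (TTs m l d).card := by
  classical
  have h1 := Finset.card_filter_add_card_filter_not (s := doors m l d) (fun x => 0 < x.2 ∧ x.2 ≤ d)
  have h2 : ((doors m l d).filter fun x => ¬ (0 < x.2 ∧ x.2 ≤ d)) =
      ((doors m l d).filter fun x => x.2 = 0) ∪
      (((doors m l d).filter fun x => x.2 = d + 1 ∧ x.1 ∉ SS n m d) ∪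
      ((doors m l d).filter fun x => x.2 = d + 1 ∧ x.1 ∈ SS n m d)) := by
    ext x
    simp only [Finset.mem_filter, Finset.mem_union]
    constructor
    · rintro ⟨h, h3⟩
      have : x.2 < d + 2 := by
        simp only [doors, Finset.mem_filter, Finset.mem_product, Finset.mem_range] at h
        exact h.1.2
      by_cases hx : x.1 ∈ SS n m d
      · by_cases h0 : x.2 = 0
        · simp [h, h0]
        · right; right; exact ⟨h, by omega, hx⟩
      · by_cases h0 : x.2 = 0
        · simp [h, h0]
        · right; left; exact ⟨h, by omega, hx⟩
    · rintro (⟨h, h3⟩ | ⟨h, h3, -⟩ | ⟨h, h3, -⟩) <;> exact ⟨h, by omega⟩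
  have h3 : ((doors m l d).filter fun x => ¬ (0 < x.2 ∧ x.2 ≤ d)).card =
      ((doors m l d).filter fun x => x.2 = 0).card +
      (((doors m l d).filter fun x => x.2 = d + 1 ∧ x.1 ∉ SS n m d).card +
      ((doors m l d).filter fun x => x.2 = d + 1 ∧ x.1 ∈ SS n m d).card) := by
    rw [h2, Finset.card_union_of_disjoint, Finset.card_union_of_disjoint]
    · rw [Finset.disjoint_filter]; rintro x - ⟨-, h⟩ ⟨-, h'⟩; exact h h'
    · rw [Finset.disjoint_union_right, Finset.disjoint_filter, Finset.disjoint_filter]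
      constructor
      · rintro x - h ⟨h', -⟩; omega
      · rintro x - h ⟨h', -⟩; omega
  rw [h3, doors_shift hl hd, doors_bdry] at h1
  rw [← h1]
  push_cast
  rw [doors_mid hd, zero_add, ← add_assoc, CharTwo.add_self_eq_zero, zero_add]

lemma TTs_odd {m : ℕ} (hm : 0 < m) {l : (Fin n → ℕ) → ℕ} (hl : Lab n m l) :
    ∀ d, d ≤ n → ((TTs m l d).card : ZMod 2) = 1 := by
  intro d
  induction d with
  | zero =>
    intro _
    have hSS : SS n m 0 = {((fun _ => 0), 1)} := by
      ext σ
      rw [mem_SS, Finset.mem_singleton]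
      constructor
      · rintro ⟨-, h⟩
        ext i
        · simpa using (h i (Nat.zero_le _)).1
        · simpa using congrArg Fin.val (h i (Nat.zero_le _)).2
      · rintro rfl
        exact ⟨fun _ => hm, fun i _ => ⟨rfl, rfl⟩⟩
    have : TTs m l 0 = {((fun _ => 0), 1)} := by
      rw [TTs, hSS, Finset.filter_singleton, if_pos]
      have h0 : l (kv ((fun _ => 0), 1) 0) = 0 := by
        have := lab_le hl (Nat.zero_le n) (σ := ((fun _ => 0), 1)) (by rw [hSS]; simp) le_rfl
        omega
      simp [h0]
    rw [this]; simp
  | succ d ih =>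
    intro hd
    rw [← doors_parity hl hd, doors_card hl hd]
    exact ih (by omega)

lemma sperner {m : ℕ} (hm : 0 < m) {l : (Fin n → ℕ) → ℕ} (hl : Lab n m l) :
    ∃ p : Fin n → ℕ, (∀ i, p i < m) ∧ ∀ j ≤ n, ∃ v : Fin n → ℕ,
      (∀ i, p i ≤ v i ∧ v i ≤ p i + 1) ∧ l v = j := by
  have h := TTs_odd hm hl n le_rfl
  have hne : (TTs m l n).Nonempty := by
    rw [Finset.nonempty_iff_ne_empty]; intro h0; rw [h0] at h; simp at h
  obtain ⟨σ, hσ⟩ := hne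
  rw [TTs, Finset.mem_filter, mem_SS] at hσ
  refine ⟨σ.1, hσ.1.1, fun j hj => ?_⟩
  have : j ∈ Finset.range (n + 1) := by simp; omega
  rw [← hσ.2] at this
  obtain ⟨k, -, hk⟩ := Finset.mem_image.1 this
  refine ⟨kv σ k, fun i => ?_, hk⟩
  simp only [kv]; split_ifs <;> omega

end Sperner

/-- Brouwer in variational inequality form on the cube. -/
lemma cube_VI {n : ℕ} (D : (Fin n → ℝ) → Fin n → ℝ)
    (hD : ContinuousOn D (Set.pi Set.univ fun _ => Set.Icc 0 1)) :
    ∃ x : Fin n → ℝ, (∀ i, x i ∈ Set.Icc (0:ℝ) 1) ∧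
      ∀ j, (x j = 0 ∨ 0 ≤ D x j) ∧ (x j = 1 ∨ D x j ≤ 0) := by
  classical
  have hstep : ∀ m : ℕ, ∃ y : Fin (n+1) → Fin n → ℝ, (∀ k i, y k i ∈ Set.Icc (0:ℝ) 1) ∧
      (∀ k i, |y k i - y 0 i| ≤ 1 / ((m:ℝ) + 1)) ∧
      (∀ i : Fin n, y i.castSucc i = 0 ∨ 0 ≤ D (y i.castSucc) i) ∧
      (∀ i : Fin n, y (Fin.last n) i = 1 ∨ D (y (Fin.last n)) i ≤ 0) := by
    intro m
    let sc : (Fin n → ℕ) → Fin n → ℝ := fun v i => (v i : ℝ) / ((m:ℝ) + 1)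
    let c : (Fin n → ℕ) → Fin n → Prop := fun v i => v i = 0 ∨ (v i ≠ m + 1 ∧ 0 ≤ D (sc v) i)
    have hex : ∀ v, ∃ k, k = n ∨ ∃ h : k < n, c v ⟨k, h⟩ := fun v => ⟨n, Or.inl rfl⟩
    let l : (Fin n → ℕ) → ℕ := fun v => Nat.find (hex v)
    have hlc : ∀ v i, c v i → l v ≤ i.val := fun v i h => Nat.find_min' (hex v) (Or.inr ⟨i.2, h⟩)
    have hcl : ∀ v (i : Fin n), l v = i.val → c v i := by
      intro v i h
      have h1 := Nat.find_spec (hex v)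
      change l v = n ∨ ∃ h : l v < n, c v ⟨l v, h⟩ at h1
      rcases h1 with h1 | ⟨h1, h2⟩
      · have := i.2; omega
      · have : i = ⟨l v, h1⟩ := Fin.ext h.symm
        rwa [this]
    have hl : Lab n (m+1) l := by
      refine ⟨fun v => Nat.find_min' (hex v) (Or.inl rfl), fun v i h => hlc v i (Or.inl h),
        fun v i h h2 => ?_⟩
      rcases hcl v i h2 with h3 | h3
      · omega
      · exact h3.1 h
    obtain ⟨p, hp, hv⟩ := sperner (Nat.succ_pos m) hl
    have hv' : ∀ k : Fin (n+1), ∃ v : Fin n → ℕ, (∀ i, p i ≤ v i ∧ v i ≤ p i + 1) ∧ l v = k.val :=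
      fun k => hv k.val (by omega)
    choose v hv1 hv2 using hv'
    have hm : (0:ℝ) < (m:ℝ) + 1 := by positivity
    refine ⟨fun k => sc (v k), fun k i => ⟨by positivity, ?_⟩, fun k i => ?_, fun i => ?_, fun i => ?_⟩
    · rw [div_le_one hm]
      have h1 := (hv1 k i).2
      have h2 := hp i
      have : v k i ≤ m + 1 := by omega
      exact_mod_cast this
    · simp only [sc]
      rw [← sub_div, abs_div, abs_of_pos hm]
      gcongr
      have h1 := hv1 k i
      have h2 := hv1 0 i
      have a1 : (v k i : ℝ) ≤ v 0 i + 1 := by exact_mod_cast (by omega : v k i ≤ v 0 i + 1)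
      have a2 : (v 0 i : ℝ) ≤ v k i + 1 := by exact_mod_cast (by omega : v 0 i ≤ v k i + 1)
      rw [abs_le]; constructor <;> linarith
    · rcases hcl (v i.castSucc) i (by rw [hv2]; simp) with h | h
      · left; simp [sc, h]
      · exact Or.inr h.2
    · have h1 : ¬ c (v (Fin.last n)) i := by
        intro h
        have := hlc _ _ h
        rw [hv2] at this
        simp at this
        omega
      simp only [c] at h1
      push Not at h1
      by_cases h2 : v (Fin.last n) i = m + 1
      · left; simp only [sc]; rw [h2]; push_cast; field_simp
      · right; exact (h1.2 h2).le
  choose y hy1 hy2 hy3 hy4 using hstep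
  have hcomp : IsCompact (Set.pi Set.univ fun _ : Fin n => Set.Icc (0:ℝ) 1) :=
    isCompact_univ_pi fun _ => isCompact_Icc
  obtain ⟨x, hx, φ, hφ, hlim⟩ := hcomp.tendsto_subseq (x := fun m => y m 0)
    (fun m i _ => hy1 m 0 i)
  have hxk : ∀ k, Filter.Tendsto (fun m => y (φ m) k) Filter.atTop (nhds x) := by
    intro k
    rw [tendsto_pi_nhds] at hlim ⊢
    intro i
    have h0 : Filter.Tendsto (fun m => y (φ m) k i - y (φ m) 0 i) Filter.atTop (nhds 0) := by
      refine squeeze_zero_norm (fun m => ?_) (tendsto_one_div_add_atTop_nhds_zero_nat.comp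
        hφ.tendsto_atTop)
      exact hy2 (φ m) k i
    have := h0.add (hlim i)
    simpa using this
  have hDk : ∀ k i, Filter.Tendsto (fun m => D (y (φ m) k) i) Filter.atTop (nhds (D x i)) := by
    intro k i
    have h1 := (hD x hx).tendsto
    have h2 : Filter.Tendsto (fun m => y (φ m) k) Filter.atTop
        (nhdsWithin x (Set.pi Set.univ fun _ => Set.Icc 0 1)) :=
      tendsto_nhdsWithin_iff.2 ⟨hxk k, Filter.Eventually.of_forall fun m i _ => hy1 _ k i⟩
    exact (continuous_apply i).continuousAt.tendsto.comp (h1.comp h2)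
  have hxi : ∀ k i, Filter.Tendsto (fun m => y (φ m) k i) Filter.atTop (nhds (x i)) := fun k i =>
    (tendsto_pi_nhds.1 (hxk k)) i
  refine ⟨x, fun i => hx i trivial, fun j => ⟨?_, ?_⟩⟩
  · by_contra hcon
    push Not at hcon
    obtain ⟨m, h1, h2⟩ := (((hxi j.castSucc j).eventually_ne hcon.1).and
      ((hDk j.castSucc j).eventually_lt_const hcon.2)).exists
    rcases hy3 (φ m) j with h | h
    · exact h1 h
    · linarith
  · by_contra hcon
    push Not at hcon
    obtain ⟨m, h1, h2⟩ := (((hxi (Fin.last n) j).eventually_ne hcon.1).and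
      ((hDk (Fin.last n) j).eventually_const_lt hcon.2)).exists
    rcases hy4 (φ m) j with h | h
    · exact h1 h
    · linarith

open MeasureTheory
noncomputable section
section Stage
variable {N : ℕ}

def PS (x : Fin N → ℝ) (S : Finset (Fin N)) : ℝ := (∏ i ∈ S, x i) * ∏ i ∈ Sᶜ, (1 - x i)

def W (ρ : Finset (Fin N) → ℝ) (x : Fin N → ℝ) (c : ℝ) : ℝ :=
  ∑ S ∈ nonempties N, PS x S * ρ S + PS x ∅ * c

def Cube (N : ℕ) : Set (Fin N → ℝ) := Set.pi Set.univ fun _ => Set.Icc 0 1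

lemma mem_Cube {x : Fin N → ℝ} : x ∈ Cube N ↔ ∀ i, x i ∈ Set.Icc (0:ℝ) 1 := by
  exact ⟨fun h i => h i trivial, fun h i _ => h i⟩

lemma Cube_update {x : Fin N → ℝ} (hx : x ∈ Cube N) (j : Fin N) {y : ℝ} (hy : y ∈ Set.Icc (0:ℝ) 1) :
    Function.update x j y ∈ Cube N := by
  rw [mem_Cube] at *
  intro i
  by_cases h : i = j
  · subst h; simpa using hy
  · simpa [h] using hx i

lemma PS_nonneg {x : Fin N → ℝ} (hx : x ∈ Cube N) (S) : 0 ≤ PS x S := by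
  rw [mem_Cube] at hx
  exact mul_nonneg (Finset.prod_nonneg fun i _ => (hx i).1)
    (Finset.prod_nonneg fun i _ => by linarith [(hx i).2])

lemma sum_PS (x : Fin N → ℝ) : ∑ S, PS x S = 1 := by
  have := Finset.prod_add (fun i => x i) (fun i => 1 - x i) (Finset.univ : Finset (Fin N))
  simp only [add_sub_cancel, Finset.prod_const_one, Finset.powerset_univ] at this
  rw [this]
  rfl

lemma sum_all (f : Finset (Fin N) → ℝ) : ∑ S, f S = ∑ S ∈ nonempties N, f S + f ∅ := by
  have h : nonempties N = Finset.univ.erase ∅ := by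
    ext; simp [nonempties]
  rw [h, Finset.sum_erase_add _ _ (Finset.mem_univ _)]

lemma sum_PS_ne (x : Fin N → ℝ) : ∑ S ∈ nonempties N, PS x S = 1 - PS x ∅ := by
  have := sum_PS x; rw [sum_all] at this; linarith

lemma PS_empty (x : Fin N → ℝ) : PS x ∅ = ∏ i, (1 - x i) := by simp [PS]

lemma PS_le_one {x : Fin N → ℝ} (hx : x ∈ Cube N) (S) : PS x S ≤ 1 := by
  rw [← sum_PS x]
  exact Finset.single_le_sum (f := PS x) (fun S _ => PS_nonneg hx S) (Finset.mem_univ S)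

lemma PS_affine (x : Fin N → ℝ) (j : Fin N) (y : ℝ) (S) : PS (Function.update x j y) S =
    y * PS (Function.update x j 1) S + (1 - y) * PS (Function.update x j 0) S := by
  classical
  by_cases hj : j ∈ S
  · have h1 : ∀ y, ∏ i ∈ S, Function.update x j y i = y * ∏ i ∈ S \ {j}, x i := fun y =>
      Finset.prod_update_of_mem hj _ _
    have h2 : ∀ y, ∏ i ∈ Sᶜ, (1 - Function.update x j y i) = ∏ i ∈ Sᶜ, (1 - x i) := fun y =>
      Finset.prod_congr rfl fun i hi => by
        rw [Function.update_of_ne]; rintro rfl; simp at hi; exact hi hj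
    simp only [PS, h1, h2]; ring
  · have h1 : ∀ y, ∏ i ∈ S, Function.update x j y i = ∏ i ∈ S, x i := fun y =>
      Finset.prod_congr rfl fun i hi => by
        rw [Function.update_of_ne]; rintro rfl; exact hj hi
    have h2 : ∀ y, ∏ i ∈ Sᶜ, (1 - Function.update x j y i) = (1 - y) * ∏ i ∈ Sᶜ \ {j}, (1 - x i) := by
      intro y
      have hj' : j ∈ Sᶜ := by simpa using hj
      rw [← Finset.mul_prod_erase _ _ hj', Function.update_self, Finset.sdiff_singleton_eq_erase]
      congr 1
      refine Finset.prod_congr rfl fun i hi => ?_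
      rw [Function.update_of_ne (Finset.mem_erase.1 hi).1]
    simp only [PS, h1, h2]; ring

lemma W_affine (ρ : Finset (Fin N) → ℝ) (x : Fin N → ℝ) (j : Fin N) (y c : ℝ) :
    W ρ (Function.update x j y) c =
    y * W ρ (Function.update x j 1) c + (1 - y) * W ρ (Function.update x j 0) c := by
  have : ∀ S, PS (Function.update x j y) S * ρ S =
    y * (PS (Function.update x j 1) S * ρ S) + (1 - y) * (PS (Function.update x j 0) S * ρ S) := by
    intro S; rw [PS_affine]; ring
  simp only [W, this, Finset.sum_add_distrib, ← Finset.mul_sum]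
  rw [PS_affine x j y ∅]; ring

lemma W_affine' (ρ : Finset (Fin N) → ℝ) (x : Fin N → ℝ) (j : Fin N) (c : ℝ) :
    W ρ x c = x j * W ρ (Function.update x j 1) c + (1 - x j) * W ρ (Function.update x j 0) c := by
  conv_lhs => rw [← Function.update_eq_self j x]
  exact W_affine ρ x j (x j) c

lemma PS_one_empty (x : Fin N → ℝ) (j : Fin N) : PS (Function.update x j 1) ∅ = 0 := by
  rw [PS_empty]; exact Finset.prod_eq_zero (Finset.mem_univ j) (by simp)

lemma W_one (ρ : Finset (Fin N) → ℝ) (x : Fin N → ℝ) (j : Fin N) (c c' : ℝ) :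
    W ρ (Function.update x j 1) c = W ρ (Function.update x j 1) c' := by
  simp [W, PS_one_empty]

lemma W_sub (ρ : Finset (Fin N) → ℝ) (x : Fin N → ℝ) (c c' : ℝ) :
    W ρ x c - W ρ x c' = PS x ∅ * (c - c') := by
  simp only [W]; ring

lemma W_mono (ρ : Finset (Fin N) → ℝ) {x : Fin N → ℝ} (hx : x ∈ Cube N) {c c' : ℝ} (h : c ≤ c') :
    W ρ x c ≤ W ρ x c' := by
  have := W_sub ρ x c' c
  have := mul_nonneg (PS_nonneg hx ∅) (sub_nonneg.2 h)
  linarith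

lemma W_update_le {ρ : Finset (Fin N) → ℝ} {x : Fin N → ℝ} {j : Fin N} {y c : ℝ}
    (hy : y ∈ Set.Icc (0:ℝ) 1) {M : ℝ} (h1 : W ρ (Function.update x j 1) c ≤ M)
    (h0 : W ρ (Function.update x j 0) c ≤ M) : W ρ (Function.update x j y) c ≤ M := by
  rw [W_affine]
  nlinarith [hy.1, hy.2]

lemma abs_W_ne_le {ρ : Finset (Fin N) → ℝ} (hρ : ∀ S, |ρ S| ≤ 1) {x : Fin N → ℝ} (hx : x ∈ Cube N) :
    |∑ S ∈ nonempties N, PS x S * ρ S| ≤ 1 - PS x ∅ := by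
  rw [← sum_PS_ne]
  refine (Finset.abs_sum_le_sum_abs _ _).trans (Finset.sum_le_sum fun S _ => ?_)
  rw [abs_mul, abs_of_nonneg (PS_nonneg hx S)]
  exact mul_le_of_le_one_right (PS_nonneg hx S) (hρ S)

lemma continuous_PS (S : Finset (Fin N)) : Continuous fun x : Fin N → ℝ => PS x S := by
  unfold PS; fun_prop

lemma continuous_W (ρ : Finset (Fin N) → ℝ) : Continuous fun p : (Fin N → ℝ) × ℝ => W ρ p.1 p.2 := by
  have := fun S => continuous_PS (N := N) S
  unfold W
  fun_prop

lemma contOn_W {α : Type*} [TopologicalSpace α] (ρ : Finset (Fin N) → ℝ) {a : α → Fin N → ℝ}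
    {b : α → ℝ} {s : Set α} (ha : ContinuousOn a s) (hb : ContinuousOn b s) :
    ContinuousOn (fun x => W ρ (a x) (b x)) s :=
  (continuous_W ρ).comp_continuousOn (f := fun x => (a x, b x)) (ha.prodMk hb)

lemma tendsto_W {α : Type*} {l : Filter α} (ρ : Finset (Fin N) → ℝ) {a : α → Fin N → ℝ}
    {b : α → ℝ} {a' : Fin N → ℝ} {b' : ℝ} (ha : Filter.Tendsto a l (nhds a'))
    (hb : Filter.Tendsto b l (nhds b')) :
    Filter.Tendsto (fun x => W ρ (a x) (b x)) l (nhds (W ρ a' b')) :=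
  ((continuous_W ρ).tendsto (a', b')).comp (f := fun x => (a x, b x)) (ha.prodMk_nhds hb)

/-- first order expansion -/
lemma one_sub_sum_le {ι : Type*} (s : Finset ι) (x : ι → ℝ) (hx : ∀ i ∈ s, x i ∈ Set.Icc (0:ℝ) 1) :
    1 - ∑ i ∈ s, x i ≤ ∏ i ∈ s, (1 - x i) := by
  classical
  induction s using Finset.induction_on with
  | empty => simp
  | insert a s ha ih =>
    rw [Finset.sum_insert ha, Finset.prod_insert ha]
    have h1 := ih fun i hi => hx i (Finset.mem_insert_of_mem hi)
    have h2 := hx a (Finset.mem_insert_self _ _)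
    have h3 : 0 ≤ ∑ i ∈ s, x i := Finset.sum_nonneg fun i hi =>
      (hx i (Finset.mem_insert_of_mem hi)).1
    nlinarith [h2.1, h2.2]

lemma PS_single_bounds {x : Fin N → ℝ} (hx : x ∈ Cube N) (k : Fin N) :
    x k - x k * ∑ i, x i ≤ PS x {k} ∧ PS x {k} ≤ x k := by
  have hx' := mem_Cube.1 hx
  have h1 : PS x {k} = x k * ∏ i ∈ ({k} : Finset (Fin N))ᶜ, (1 - x i) := by simp [PS]
  have h2 := one_sub_sum_le ({k} : Finset (Fin N))ᶜ x fun i _ => hx' i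
  have h3 : ∑ i ∈ ({k} : Finset (Fin N))ᶜ, x i ≤ ∑ i, x i :=
    Finset.sum_le_sum_of_subset_of_nonneg (Finset.subset_univ _) fun i _ _ => (hx' i).1
  have h4 : ∏ i ∈ ({k} : Finset (Fin N))ᶜ, (1 - x i) ≤ 1 :=
    Finset.prod_le_one (fun i _ => by linarith [(hx' i).2]) fun i _ => by linarith [(hx' i).1]
  rw [h1]
  constructor <;> nlinarith [(hx' k).1]

lemma W_expand {ρ : Finset (Fin N) → ℝ} (hρ : ∀ S, |ρ S| ≤ 1) {x : Fin N → ℝ} (hx : x ∈ Cube N)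
    (c : ℝ) : |W ρ x c - ((1 - ∑ i, x i) * c + ∑ k, x k * ρ {k})| ≤
      (2 + |c|) * (∑ i, x i) ^ 2 := by
  classical
  have hx' := mem_Cube.1 hx
  set s := ∑ i, x i with hs
  -- singletons
  let T : Finset (Finset (Fin N)) := Finset.univ.image fun k : Fin N => ({k} : Finset (Fin N))
  have hT : T ⊆ nonempties N := by
    intro S hS
    obtain ⟨k, -, rfl⟩ := Finset.mem_image.1 hS
    simp [nonempties]
  have hTs : ∀ f : Finset (Fin N) → ℝ, ∑ S ∈ T, f S = ∑ k, f {k} := fun f =>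
    Finset.sum_image fun a _ b _ h => Finset.singleton_injective h
  have e1 := Finset.sum_sdiff hT (f := PS x)
  have e2 := Finset.sum_sdiff hT (f := fun S => PS x S * ρ S)
  rw [hTs, sum_PS_ne] at e1
  rw [hTs] at e2
  have b1 : s - s * s ≤ ∑ k, PS x {k} := by
    have : ∑ k, (x k - x k * s) ≤ ∑ k, PS x {k} :=
      Finset.sum_le_sum fun k _ => (PS_single_bounds hx k).1
    rwa [Finset.sum_sub_distrib, ← Finset.sum_mul] at this
  have b2 : 1 - s ≤ PS x ∅ := by
    rw [PS_empty]; exact one_sub_sum_le Finset.univ x fun i _ => hx' i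
  have b3 : 0 ≤ ∑ S ∈ nonempties N \ T, PS x S := Finset.sum_nonneg fun S _ => PS_nonneg hx S
  have b4 : |∑ S ∈ nonempties N \ T, PS x S * ρ S| ≤ ∑ S ∈ nonempties N \ T, PS x S := by
    refine (Finset.abs_sum_le_sum_abs _ _).trans (Finset.sum_le_sum fun S _ => ?_)
    rw [abs_mul, abs_of_nonneg (PS_nonneg hx S)]
    exact mul_le_of_le_one_right (PS_nonneg hx S) (hρ S)
  have b5 : |∑ k, PS x {k} * ρ {k} - ∑ k, x k * ρ {k}| ≤ s * s := by
    rw [← Finset.sum_sub_distrib]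
    refine (Finset.abs_sum_le_sum_abs _ _).trans ?_
    rw [hs, Finset.sum_mul]
    refine Finset.sum_le_sum fun k _ => ?_
    rw [← sub_mul, abs_mul]
    have := PS_single_bounds hx k
    have h1 : |PS x {k} - x k| ≤ x k * ∑ i, x i := by
      rw [abs_le]; constructor
      · linarith [this.1]
      · have : 0 ≤ x k * ∑ i, x i := mul_nonneg (hx' k).1 (Finset.sum_nonneg fun i _ => (hx' i).1)
        linarith [(PS_single_bounds hx k).2]
    exact (mul_le_of_le_one_right (abs_nonneg _) (hρ _)).trans h1
  have b6 : |(PS x ∅ - (1 - s)) * c| ≤ s * s * |c| := by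
    rw [abs_mul]
    gcongr
    rw [abs_le]; constructor <;> nlinarith
  have : W ρ x c - ((1 - s) * c + ∑ k, x k * ρ {k}) =
    (∑ S ∈ nonempties N \ T, PS x S * ρ S) + (∑ k, PS x {k} * ρ {k} - ∑ k, x k * ρ {k}) +
      (PS x ∅ - (1 - s)) * c := by
    simp only [W]; rw [← e2]; ring
  rw [this]
  refine (abs_add_three _ _ _).trans ?_
  nlinarith
end Stage
end

open MeasureTheory
noncomputable section
section NonQ
variable {N : ℕ}

lemma aux_eq (r : Finset (Fin N) → Fin N → ℝ) (hr : ∀ S i, |r S i| ≤ 1) (q : Fin N → ℝ) {B : ℝ}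
    (hB : 1 ≤ B) (hq : ∀ j, |q j| ≤ B) {lam : ℝ} (h0 : 0 < lam) (h1 : lam ≤ 1) :
    ∃ x ∈ Cube N, ∃ γ : Fin N → ℝ, ∀ j, |γ j| ≤ B ∧
      W (fun S => r S j) x ((1 - lam) * γ j + lam * q j) = γ j ∧
      W (fun S => r S j) (Function.update x j 1) 0 ≤ γ j ∧
      W (fun S => r S j) (Function.update x j 0) ((1 - lam) * γ j + lam * q j) ≤ γ j ∧
      (x j = 0 ∨ γ j = W (fun S => r S j) (Function.update x j 1) 0) := by
  classical
  let g : (Fin N → ℝ) → Fin N → ℝ := fun x j =>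
    (∑ S ∈ nonempties N, PS x S * r S j + PS x ∅ * (lam * q j)) / (1 - PS x ∅ * (1 - lam))
  have hden : ∀ x ∈ Cube N, 0 < 1 - PS x ∅ * (1 - lam) := fun x hx => by
    have a := PS_nonneg hx ∅
    have b := PS_le_one hx ∅
    nlinarith
  let D : (Fin N → ℝ) → Fin N → ℝ := fun x j => W (fun S => r S j) (Function.update x j 1) 0 -
    W (fun S => r S j) (Function.update x j 0) ((1 - lam) * g x j + lam * q j)
  have hgc : ∀ j, ContinuousOn (fun x => g x j) (Cube N) := by
    intro j
    have := fun S => continuous_PS (N := N) S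
    refine ContinuousOn.div (by fun_prop) (by fun_prop) fun x hx => (hden x hx).ne'
  have hDc : ContinuousOn D (Cube N) := by
    rw [continuousOn_pi]
    intro j
    have hg := hgc j
    refine ContinuousOn.sub ?_ ?_
    · exact contOn_W _ (Continuous.continuousOn (by fun_prop)) continuousOn_const
    · refine contOn_W _ (Continuous.continuousOn (by fun_prop)) ?_
      exact (continuousOn_const.mul hg).add continuousOn_const
  obtain ⟨x, hx, hVI⟩ := cube_VI D hDc
  have hxC : x ∈ Cube N := mem_Cube.2 hx
  refine ⟨x, hxC, g x, fun j => ?_⟩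
  have hd := hden x hxC
  have hWg : W (fun S => r S j) x ((1 - lam) * g x j + lam * q j) = g x j := by
    have : g x j * (1 - PS x ∅ * (1 - lam)) =
      (∑ S ∈ nonempties N, PS x S * r S j + PS x ∅ * (lam * q j)) := div_mul_cancel₀ _ hd.ne'
    simp only [W]; linarith
  have haff := W_affine' (fun S => r S j) x j ((1 - lam) * g x j + lam * q j)
  rw [hWg, W_one _ x j _ 0] at haff
  have hVj := hVI j
  have hxj := hx j
  simp only [D] at hVj
  refine ⟨?_, hWg, ?_, ?_, ?_⟩
  · simp only [g]
    rw [abs_div, abs_of_pos hd, div_le_iff₀ hd]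
    have a1 := abs_le.1 (abs_W_ne_le (ρ := fun S => r S j) (fun S => hr S j) hxC)
    have a2 := PS_nonneg hxC ∅
    have a3 : |PS x ∅ * (lam * q j)| ≤ PS x ∅ * (lam * B) := by
      rw [abs_mul, abs_mul, abs_of_nonneg a2, abs_of_pos h0]
      exact mul_le_mul_of_nonneg_left (mul_le_mul_of_nonneg_left (hq j) h0.le) a2
    have a4 := abs_le.1 a3
    have a5 := PS_le_one hxC ∅
    have a6 : 1 - PS x ∅ ≤ B * (1 - PS x ∅) := by nlinarith
    rw [abs_le]; constructor <;> nlinarith [a1.1, a1.2, a4.1, a4.2]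
  all_goals
    generalize W (fun S => r S j) (Function.update x j 1) 0 = Q at *
    generalize W (fun S => r S j) (Function.update x j 0) _ = C at *
    rcases hVj with ⟨h | h, h' | h'⟩
  · rw [h] at h'; norm_num at h'
  · rw [h] at haff; linarith
  · rw [h'] at haff; linarith
  · have : Q = C := by linarith
    rw [this] at haff ⊢; linarith
  · rw [h] at h'; norm_num at h'
  · rw [h] at haff; linarith
  · rw [h'] at haff; linarith
  · have : Q = C := by linarith
    rw [this] at haff; linarith
  · exact Or.inl h
  · exact Or.inl h
  · right; rw [h'] at haff; linarith
  · right
    have : Q = C := by linarith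
    rw [this] at haff ⊢; linarith

open Filter Topology

/-- outside of J the continuation payoff is bounded below. -/
lemma outside_lb {ρ : Finset (Fin N) → ℝ} (hρ : ∀ S, |ρ S| ≤ 1) {x : Fin N → ℝ} (hx : x ∈ Cube N)
    {j : Fin N} {μ : ℝ} (hμ0 : 0 < μ) (hμ1 : μ ≤ 1) (hμ : ∀ k, k ≠ j → μ ≤ ρ {k}) {lam g B : ℝ} (h0 : 0 < lam)
    (h1 : lam ≤ 1) (hB : 1 ≤ B) (hg : |g| ≤ B)
    (hW : W ρ (Function.update x j 0) ((1 - lam) * g + lam * 1) ≤ g)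
    (hs : (2 + B) * (∑ i, Function.update x j 0 i) ≤ μ / 4) : μ / 2 ≤ g := by
  have hx' := Cube_update hx j (y := 0) (by simp)
  set y := Function.update x j 0 with hy
  set s := ∑ i, y i with hs'
  have hs0 : 0 ≤ s := Finset.sum_nonneg fun i _ => (mem_Cube.1 hx' i).1
  set c := (1 - lam) * g + lam * 1 with hc
  have hcB : |c| ≤ B := by
    have := abs_le.1 hg
    rw [abs_le]; constructor <;> nlinarith
  have he := (abs_le.1 (W_expand hρ hx' c)).1
  have hsum : μ * s ≤ ∑ k, y k * ρ {k} := by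
    rw [hs', Finset.mul_sum]
    refine Finset.sum_le_sum fun k _ => ?_
    by_cases hk : k = j
    · have : y k = 0 := by rw [hk, hy]; simp
      simp [this]
    · have := hμ k hk
      have := (mem_Cube.1 hx' k).1
      nlinarith
  have h3 : (2 + |c|) * s ^ 2 ≤ s * (μ / 4) := by
    have : (2 + |c|) * s ^ 2 ≤ (2 + B) * s ^ 2 := by gcongr
    nlinarith
  by_contra hlt
  push Not at hlt
  have hs1 : s ≤ 1 / 12 := by nlinarith
  have h4 : (1 - s) * c + μ * s - s * (μ / 4) ≤ g := by linarith
  rw [hc] at h4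
  have h5 : (s + lam - s * lam) * g ≤ (s + lam - s * lam) * (μ / 2) := by
    apply mul_le_mul_of_nonneg_left hlt.le; nlinarith
  have h6 : (1 - s) * lam + μ * s - s * (μ / 4) ≤ (s + lam - s * lam) * (μ / 2) := by nlinarith
  have h7 : 0 < (1 - s) * lam := by apply mul_pos <;> linarith
  nlinarith [mul_nonneg hs0 hμ0.le]

theorem nonQ_cases (r : Finset (Fin N) → Fin N → ℝ) (hr : ∀ S i, |r S i| ≤ 1)
    (hdiag : ∀ i, r {i} i = 0) (J : Finset (Fin N))
    (hJ : ∀ j, j ∉ J → ∀ k, k ≠ j → 0 < r {k} j)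
    (hQ : ¬ IsQ (fun i j => r {i} j) J) :
    (∃ z, LCPsol (fun i j => r {i} j) J (fun _ => 0) z ∧ 0 < ∑ i, z i) ∨
    ∃ x ∈ Cube N, x ≠ 0 ∧ ∃ γ : Fin N → ℝ, (∀ j, W (fun S => r S j) x (γ j) = γ j ∧
      W (fun S => r S j) (Function.update x j 1) 0 ≤ γ j ∧
      W (fun S => r S j) (Function.update x j 0) (γ j) ≤ γ j) ∧
      ∀ i, (∀ k, k ≠ i → x k = 0) → i ∈ J := by
  classical
  simp only [IsQ, not_forall, not_exists] at hQ
  obtain ⟨q', hq'⟩ := hQ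
  let q : Fin N → ℝ := fun j => if j ∈ J then q' j else 1
  have hq : ∀ z, ¬ LCPsol (fun i j => r {i} j) J q z := by
    intro z hz
    refine hq' z ⟨hz.nonneg, hz.supp, fun j hj => ?_, fun j hj => ?_⟩
    · simpa [q, hj] using hz.feas j hj
    · simpa [q, hj] using hz.compl j hj
  have hq1 : ∀ j, j ∉ J → q j = 1 := fun j hj => by simp [q, hj]
  set B := 1 + ∑ j, |q j| with hBd
  have hB : 1 ≤ B := by
    have : 0 ≤ ∑ j, |q j| := Finset.sum_nonneg fun _ _ => abs_nonneg _
    linarith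
  have hqB : ∀ j, |q j| ≤ B := fun j => by
    have := Finset.single_le_sum (f := fun j => |q j|) (fun i _ => abs_nonneg _) (Finset.mem_univ j)
    linarith
  let lam : ℕ → ℝ := fun n => 1 / ((n:ℝ) + 1)
  have hl0 : ∀ n, 0 < lam n := fun n => by positivity
  have hl1 : ∀ n, lam n ≤ 1 := fun n => by
    simp only [lam]; rw [div_le_one (by positivity)]; linarith [(Nat.cast_nonneg n : (0:ℝ) ≤ n)]
  have hlt : Tendsto lam atTop (𝓝 0) := tendsto_one_div_add_atTop_nhds_zero_nat
  have hex := fun n => aux_eq r hr q hB hqB (hl0 n) (hl1 n)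
  choose X hX G hG using hex
  have hXm := fun n => mem_Cube.1 (hX n)
  let s : ℕ → ℝ := fun n => ∑ i, X n i
  have hs0 : ∀ n, 0 ≤ s n := fun n => Finset.sum_nonneg fun i _ => (hXm n i).1
  let σ : ℕ → ℝ := fun n => s n + lam n
  have hσ : ∀ n, 0 < σ n := fun n => add_pos_of_nonneg_of_pos (hs0 n) (hl0 n)
  let Y : ℕ → (Fin N → ℝ) := fun n i => X n i / σ n
  let y0 : ℕ → ℝ := fun n => lam n / σ n
  have hXle : ∀ n i, X n i ≤ s n := fun n i =>
    Finset.single_le_sum (f := X n) (fun i _ => (hXm n i).1) (Finset.mem_univ i)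
  have hYm : ∀ n, Y n ∈ Cube N := fun n => mem_Cube.2 fun i =>
    ⟨div_nonneg (hXm n i).1 (hσ n).le, by
      rw [div_le_one (hσ n)]; linarith [hXle n i, hl0 n, show σ n = s n + lam n from rfl]⟩
  have hy0m : ∀ n, y0 n ∈ Set.Icc (0:ℝ) 1 := fun n => ⟨div_nonneg (hl0 n).le (hσ n).le, by
      rw [div_le_one (hσ n)]; linarith [hs0 n, show σ n = s n + lam n from rfl]⟩
  have hsum1 : ∀ n, ∑ i, Y n i + y0 n = 1 := fun n => by
    simp only [Y, y0]
    rw [← Finset.sum_div, ← add_div]; exact div_self (hσ n).ne'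
  have hcc : IsCompact (Cube N) := isCompact_univ_pi fun _ => isCompact_Icc
  have hcG : IsCompact (Set.pi Set.univ fun _ : Fin N => Set.Icc (-B) B) :=
    isCompact_univ_pi fun _ => isCompact_Icc
  have hcomp := (hcc.prod hcG).prod (hcc.prod (isCompact_Icc (a := (0:ℝ)) (b := 1)))
  obtain ⟨⟨⟨x, γ⟩, ⟨z, z0⟩⟩, ⟨⟨hxm, hγm⟩, hzm, hz0m⟩, φ, hφ, hlim⟩ :=
    hcomp.tendsto_subseq (x := fun n => ((X n, G n), (Y n, y0 n)))
    (fun n => ⟨⟨hX n, fun j _ => abs_le.1 (hG n j).1⟩, hYm n, hy0m n⟩)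
  have hlX : Tendsto (fun n => X (φ n)) atTop (𝓝 x) := (Prod.tendsto_iff _ _).1
    ((Prod.tendsto_iff _ _).1 hlim).1 |>.1
  have hlG : Tendsto (fun n => G (φ n)) atTop (𝓝 γ) := (Prod.tendsto_iff _ _).1
    ((Prod.tendsto_iff _ _).1 hlim).1 |>.2
  have hlY : Tendsto (fun n => Y (φ n)) atTop (𝓝 z) := (Prod.tendsto_iff _ _).1
    ((Prod.tendsto_iff _ _).1 hlim).2 |>.1
  have hly : Tendsto (fun n => y0 (φ n)) atTop (𝓝 z0) := (Prod.tendsto_iff _ _).1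
    ((Prod.tendsto_iff _ _).1 hlim).2 |>.2
  have hlGj : ∀ j, Tendsto (fun n => G (φ n) j) atTop (𝓝 (γ j)) := tendsto_pi_nhds.1 hlG
  have hlYj : ∀ j, Tendsto (fun n => Y (φ n) j) atTop (𝓝 (z j)) := tendsto_pi_nhds.1 hlY
  have hll : Tendsto (fun n => lam (φ n)) atTop (𝓝 0) := hlt.comp hφ.tendsto_atTop
  have hlc : ∀ j, Tendsto (fun n => (1 - lam (φ n)) * G (φ n) j + lam (φ n) * q j) atTop
      (𝓝 (γ j)) := by
    intro j
    have := ((hll.const_sub 1).mul (hlGj j)).add (hll.mul_const (q j))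
    simpa using this
  have hlu : ∀ j (y : ℝ), Tendsto (fun n => Function.update (X (φ n)) j y) atTop
      (𝓝 (Function.update x j y)) := fun j y => by
    have : Continuous fun w : Fin N → ℝ => Function.update w j y := by fun_prop
    exact (this.tendsto x).comp hlX
  have hlW : ∀ (j : Fin N) (a : ℕ → Fin N → ℝ) (b : ℕ → ℝ) (a' : Fin N → ℝ) (b' : ℝ),
      Tendsto a atTop (𝓝 a') → Tendsto b atTop (𝓝 b') →
      Tendsto (fun n => W (fun S => r S j) (a n) (b n)) atTop (𝓝 (W (fun S => r S j) a' b')) := by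
    intro j a b a' b' ha hb
    exact tendsto_W _ ha hb
  have hE1 : ∀ j, W (fun S => r S j) x (γ j) = γ j := fun j =>
    tendsto_nhds_unique (hlW j _ _ _ _ hlX (hlc j)) (by
      refine (hlGj j).congr fun n => ((hG (φ n) j).2.1).symm)
  have hlQ : ∀ j, Tendsto (fun n => W (fun S => r S j) (Function.update (X (φ n)) j 1) 0) atTop
      (𝓝 (W (fun S => r S j) (Function.update x j 1) 0)) := fun j =>
    hlW j _ _ _ _ (hlu j 1) tendsto_const_nhds
  have hE2 : ∀ j, W (fun S => r S j) (Function.update x j 1) 0 ≤ γ j := fun j =>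
    le_of_tendsto_of_tendsto' (hlQ j) (hlGj j) fun n => (hG (φ n) j).2.2.1
  have hE3 : ∀ j, W (fun S => r S j) (Function.update x j 0) (γ j) ≤ γ j := fun j =>
    le_of_tendsto_of_tendsto' (hlW j _ _ _ _ (hlu j 0) (hlc j)) (hlGj j)
      fun n => (hG (φ n) j).2.2.2.1
  -- players outside of J
  have hout : ∀ j, j ∉ J → Function.update x j 0 = 0 → 0 < γ j := by
    intro j hj hx0
    obtain ⟨μ, hμ0, hμ1, hμ⟩ : ∃ μ : ℝ, 0 < μ ∧ μ ≤ 1 ∧ ∀ k, k ≠ j → μ ≤ r {k} j := by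
      obtain ⟨k0, -, hk0⟩ := Finset.exists_min_image Finset.univ
        (fun k => if k = j then (1:ℝ) else r {k} j) ⟨j, Finset.mem_univ j⟩
      refine ⟨if k0 = j then (1:ℝ) else r {k0} j, ?_, ?_, fun k hk => ?_⟩
      · split_ifs with h
        · exact one_pos
        · exact hJ j hj k0 h
      · simpa using hk0 j (Finset.mem_univ j)
      · simpa [hk] using hk0 k (Finset.mem_univ k)
    have hst : Tendsto (fun n => (2 + B) * ∑ i, Function.update (X (φ n)) j 0 i) atTop (𝓝 0) := by
      have h1 := hlu j 0
      rw [hx0] at h1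
      have h2 : Continuous fun w : Fin N → ℝ => (2 + B) * ∑ i, w i := by fun_prop
      have := (h2.tendsto 0).comp h1
      simp only [Pi.zero_apply, Finset.sum_const_zero, mul_zero] at this
      exact this
    have hev : ∀ᶠ n in atTop, μ / 2 ≤ G (φ n) j := by
      filter_upwards [hst.eventually_le_const (show (0:ℝ) < μ / 4 by positivity)] with n hn
      have h3 := hG (φ n) j
      refine outside_lb (ρ := fun S => r S j) (fun S => hr S j) (hX (φ n)) hμ0 hμ1 hμ (hl0 (φ n))
        (hl1 (φ n)) hB h3.1 ?_ hn
      have := h3.2.2.2.1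
      rwa [hq1 j hj] at this
    have := ge_of_tendsto (hlGj j) hev
    linarith
  have hsingle : ∀ j (y c : ℝ), W (fun S => r S j) (Function.update (0 : Fin N → ℝ) j y) c = (1 - y) * c := by
    intro j y c
    have hm1 : Function.update (0 : Fin N → ℝ) j 1 ∈ Cube N :=
      Cube_update (mem_Cube.2 fun i => by simp) j (by simp)
    rw [W_affine]
    have h0 : W (fun S => r S j) (Function.update (0 : Fin N → ℝ) j 0) c = c := by
      have : Function.update (0 : Fin N → ℝ) j 0 = 0 := Function.update_eq_self j (0 : Fin N → ℝ)
      rw [this]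
      have := W_expand (ρ := fun S => r S j) (fun S => hr S j) (x := 0) (mem_Cube.2 fun i => by simp) c
      simp at this
      linarith
    have h1 : W (fun S => r S j) (Function.update (0 : Fin N → ℝ) j 1) c = 0 := by
      have hPS : ∀ S, S ≠ {j} → PS (Function.update (0 : Fin N → ℝ) j 1) S = 0 := by
        intro S hS
        by_cases hjS : j ∈ S
        · obtain ⟨k, hk, hkj⟩ : ∃ k ∈ S, k ≠ j := by
            by_contra hcon
            push Not at hcon
            exact hS (Finset.eq_singleton_iff_unique_mem.2 ⟨hjS, hcon⟩)
          rw [PS, Finset.prod_eq_zero hk (by simp [hkj]), zero_mul]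
        · have hjS' : j ∈ Sᶜ := by simpa using hjS
          rw [PS, Finset.prod_eq_zero hjS' (by simp), mul_zero]
      simp only [W]
      rw [hPS ∅ (by simp), zero_mul, add_zero]
      refine Finset.sum_eq_zero fun S _ => ?_
      by_cases hS : S = {j}
      · rw [hS, hdiag, mul_zero]
      · rw [hPS S hS, zero_mul]
    rw [h0, h1]; ring
  by_cases hx : x = 0
  swap
  · right
    refine ⟨x, hxm, hx, γ, fun j => ⟨hE1 j, hE2 j, hE3 j⟩, fun i hi => ?_⟩
    by_contra hiJ
    have hx0 : Function.update x i 0 = 0 := by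
      funext k
      by_cases hk : k = i
      · rw [hk]; simp
      · simp [hk, hi k hk]
    have hpos := hout i hiJ hx0
    have hxi : x i ≠ 0 := by
      intro h; apply hx; funext k
      by_cases hk : k = i
      · rw [hk]; exact h
      · exact hi k hk
    have h1 := hE1 i
    have hxu : x = Function.update (0 : Fin N → ℝ) i (x i) := by
      funext k
      by_cases hk : k = i
      · rw [hk]; simp
      · simp [hk, hi k hk]
    rw [hxu, hsingle] at h1
    have : x i * γ i = 0 := by linarith
    rcases mul_eq_zero.1 this with h | h
    · exact hxi h
    · linarith
  · left
    subst hx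
    have hγ0 : ∀ j, 0 ≤ γ j := fun j => by
      have := hE2 j; rw [hsingle] at this; simpa using this
    have hlQ0 : ∀ j, Tendsto (fun n => W (fun S => r S j) (Function.update (X (φ n)) j 1) 0) atTop
      (𝓝 0) := fun j => by
        have := hlQ j; rw [hsingle] at this; simpa using this
    have hfreq : ∀ j, γ j ≠ 0 → ∀ᶠ n in atTop, X (φ n) j = 0 := by
      intro j hj
      have h1 : ∀ᶠ n in atTop, G (φ n) j -
          W (fun S => r S j) (Function.update (X (φ n)) j 1) 0 ≠ 0 :=
        ((hlGj j).sub (hlQ0 j)).eventually_ne (by simpa using hj)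
      filter_upwards [h1] with n hn
      rcases (hG (φ n) j).2.2.2.2 with h | h
      · exact h
      · exact absurd (by linarith) hn
    have hzγ : ∀ j, γ j ≠ 0 → z j = 0 := by
      intro j hj
      refine tendsto_nhds_unique (hlYj j) ?_
      refine tendsto_const_nhds.congr' ?_
      filter_upwards [hfreq j hj] with n hn
      simp [Y, hn]
    have hst : Tendsto (fun n => s (φ n)) atTop (𝓝 0) := by
      have h2 : Continuous fun w : Fin N → ℝ => ∑ i, w i := by fun_prop
      have := (h2.tendsto 0).comp hlX
      simp only [Pi.zero_apply, Finset.sum_const_zero] at this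
      exact this
    have hw : ∀ j, γ j = z0 * q j + mulR (fun i j => r {i} j) z j := by
      intro j
      have hbound : ∀ n, |G n j - (y0 n * q j + ∑ k, Y n k * r {k} j)| ≤ (2 + 3 * B) * s n := by
        intro n
        have hg := hG n j
        set c := (1 - lam n) * G n j + lam n * q j with hc
        have hcB : |c| ≤ B := by
          have a := abs_le.1 hg.1
          have b := abs_le.1 (hqB j)
          have h0 := hl0 n
          have h1 := hl1 n
          rw [abs_le]; constructor <;> nlinarith
        have he := W_expand (ρ := fun S => r S j) (fun S => hr S j) (hX n) c
        rw [hg.2.1] at he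
        have he2 : |G n j - ((1 - s n) * c + ∑ k, X n k * r {k} j)| ≤ (2 + B) * s n ^ 2 :=
          he.trans (by gcongr)
        have hid : (G n j - (y0 n * q j + ∑ k, Y n k * r {k} j)) =
            ((G n j - ((1 - s n) * c + ∑ k, X n k * r {k} j)) + s n * lam n * (G n j - q j)) / σ n := by
          have h1 : ∑ k, Y n k * r {k} j = (∑ k, X n k * r {k} j) / σ n := by
            rw [Finset.sum_div]; refine Finset.sum_congr rfl fun k _ => ?_
            simp only [Y]; ring
          rw [h1, eq_div_iff (hσ n).ne']
          simp only [y0]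
          have := (hσ n).ne'
          field_simp
          simp only [σ, hc]
          ring
        rw [hid, abs_div, abs_of_pos (hσ n), div_le_iff₀ (hσ n)]
        refine (abs_add_le _ _).trans ?_
        have h3 : |s n * lam n * (G n j - q j)| ≤ s n * lam n * (2 * B) := by
          rw [abs_mul, abs_of_nonneg (mul_nonneg (hs0 n) (hl0 n).le)]
          refine mul_le_mul_of_nonneg_left ?_ (mul_nonneg (hs0 n) (hl0 n).le)
          have a := abs_le.1 hg.1
          have b := abs_le.1 (hqB j)
          rw [abs_le]; constructor <;> linarith
        have h4 := hs0 n
        have h5 := hl0 n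
        have h6 := mul_nonneg h4 h5.le
        have h7 := mul_nonneg h4 h4
        have : (2 + 3 * B) * s n * σ n = (2 + 3 * B) * (s n * s n) + (2 + 3 * B) * (s n * lam n) := by
          simp only [σ]; ring
        rw [this]
        nlinarith [mul_nonneg (show 0 ≤ B by linarith) h6, mul_nonneg (show 0 ≤ B by linarith) h7]
      have ht : Tendsto (fun n => G (φ n) j - (y0 (φ n) * q j + ∑ k, Y (φ n) k * r {k} j)) atTop
          (𝓝 0) := by
        refine squeeze_zero_norm (fun n => hbound (φ n)) ?_
        simpa using hst.const_mul (2 + 3 * B)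
      have ht2 : Tendsto (fun n => G (φ n) j - (y0 (φ n) * q j + ∑ k, Y (φ n) k * r {k} j)) atTop
          (𝓝 (γ j - (z0 * q j + ∑ k, z k * r {k} j))) :=
        (hlGj j).sub ((hly.mul_const _).add (tendsto_finsetSum _ fun k _ => (hlYj k).mul_const _))
      have := tendsto_nhds_unique ht2 ht
      simp only [mulR]; linarith
    have hz0' := mem_Cube.1 hzm
    have hsz : ∑ i, z i + z0 = 1 := by
      refine tendsto_nhds_unique ((tendsto_finsetSum _ fun k _ => hlYj k).add hly) ?_
      simp only [hsum1]; exact tendsto_const_nhds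
    have hsupp : ∀ j, j ∉ J → z j = 0 := fun j hj =>
      hzγ j (hout j hj (Function.update_eq_self j (0 : Fin N → ℝ))).ne'
    by_cases hz00 : z0 = 0
    · refine ⟨z, ⟨fun i => (hz0' i).1, hsupp, fun j _ => ?_, fun j _ => ?_⟩, by rw [hz00] at hsz; linarith⟩
      · have := hw j; rw [hz00] at this; linarith [hγ0 j]
      · have h1 := hw j
        rw [hz00, zero_mul] at h1
        rw [← h1]
        by_cases h : γ j = 0
        · rw [h, mul_zero]
        · rw [hzγ j h, zero_mul]
    · exfalso
      have hzp : 0 < z0 := lt_of_le_of_ne hz0m.1 (Ne.symm hz00)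
      have hsol : LCPsol (fun i j => r {i} j) J (fun j => z0 * q j) z := by
        refine ⟨fun i => (hz0' i).1, hsupp, fun j _ => ?_, fun j _ => ?_⟩
        · rw [← hw j]; exact hγ0 j
        · rw [← hw j]
          by_cases h : γ j = 0
          · rw [h, mul_zero]
          · rw [hzγ j h, zero_mul]
      have := hsol.scale (t := z0⁻¹) (by positivity)
      simp only [inv_mul_cancel_left₀ hz00] at this
      exact hq _ this
end NonQ
end

open MeasureTheory

noncomputable section

variable {N : ℕ}

/-- The uniform law on the unit interval. -/
def nuU : Measure ℝ := volume.restrict (Set.Icc 0 1)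

instance : IsProbabilityMeasure nuU := ⟨by simp [nuU]⟩

instance (t : ℕ) : IsProbabilityMeasure (signalMeasure t) := by
  have : signalMeasure t = Measure.pi fun _ => nuU := rfl
  rw [this]; infer_instance

lemma measurable_snoc {t : ℕ} :
    Measurable fun p : (Fin t → ℝ) × ℝ => (Fin.snoc p.1 p.2 : Fin (t+1) → ℝ) := by
  refine measurable_pi_iff.2 fun k => ?_
  refine Fin.lastCases ?_ (fun k => ?_) k
  · simpa using measurable_snd
  · simp only [Fin.snoc_castSucc]; fun_prop

lemma measurable_init {t : ℕ} : Measurable fun s : Fin (t+1) → ℝ => (Fin.init s : Fin t → ℝ) := by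
  refine measurable_pi_iff.2 fun k => ?_
  exact measurable_pi_apply _

lemma integrable_bdd {α : Type*} [MeasurableSpace α] {μ : Measure α} [IsFiniteMeasure μ]
    {f : α → ℝ} (hf : Measurable f) {B : ℝ} (hB : ∀ s, |f s| ≤ B) : Integrable f μ :=
  Integrable.of_bound hf.aestronglyMeasurable B (Filter.Eventually.of_forall hB)

lemma int_snoc {t : ℕ} {f : (Fin (t+1) → ℝ) → ℝ} (hf : Measurable f) {B : ℝ}
    (hB : ∀ s, |f s| ≤ B) :
    ∫ s, f s ∂(signalMeasure (t+1)) =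
      ∫ h, ∫ u, f (Fin.snoc h u : Fin (t+1) → ℝ) ∂nuU ∂(signalMeasure t) := by
  have h1 := (measurePreserving_piFinSuccAbove (fun _ : Fin (t+1) => nuU) (Fin.last t)).symm
  have h2 := h1.integral_comp' f
  have h3 : ∀ p : ℝ × (Fin t → ℝ),
      (MeasurableEquiv.piFinSuccAbove (fun _ => ℝ) (Fin.last t)).symm p
        = (Fin.snoc p.2 p.1 : Fin (t+1) → ℝ) := by
    intro p
    exact Fin.insertNth_last' p.1 p.2
  simp only [h3] at h2
  have h4 : signalMeasure (t+1) = Measure.pi fun _ => nuU := rfl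
  rw [h4, ← h2, integral_prod_symm]
  · rfl
  · refine integrable_bdd (hf.comp (measurable_snoc.comp measurable_swap)) (B := B) ?_
    intro p; exact hB _

/-- survival probability along a signal history -/
def surv (ξ : Fin N → SunspotStrategy) (t : ℕ) (s : Fin t → ℝ) : ℝ :=
  ∏ u : Fin t, ∏ i : Fin N, (1 - ξ i u.1 fun k => s (Fin.castLE u.2 k))

lemma termProb_eq (ξ : Fin N → SunspotStrategy) (t : ℕ) (S : Finset (Fin N)) :
    sunspotTermProb ξ t S =
      ∫ s, surv ξ t (Fin.init s) * PS (fun i => ξ i t s) S ∂(signalMeasure (t+1)) := rfl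

lemma surv_succ (ξ : Fin N → SunspotStrategy) (t : ℕ) (s : Fin (t+1) → ℝ) :
    surv ξ (t+1) s = surv ξ t (Fin.init s) * PS (fun i => ξ i t s) ∅ := by
  rw [PS_empty]
  unfold surv
  rw [Fin.prod_univ_castSucc]
  rfl


lemma valid_cube {ξ : Fin N → SunspotStrategy} (hξ : ∀ i, ValidSunspotStrategy (ξ i)) (t) (s) : (fun i => ξ i t s) ∈ Cube N := mem_Cube.2 fun i => (hξ i t).2 s

lemma measurable_surv {ξ : Fin N → SunspotStrategy} (hξ : ∀ i, ValidSunspotStrategy (ξ i)) (t : ℕ) : Measurable (surv ξ t) := by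
  unfold surv
  refine Finset.measurable_prod _ fun u _ => Finset.measurable_prod _ fun i _ => ?_
  refine measurable_const.sub ((hξ i u).1.comp ?_)
  exact measurable_pi_iff.2 fun k => measurable_pi_apply _

lemma surv_mem {ξ : Fin N → SunspotStrategy} (hξ : ∀ i, ValidSunspotStrategy (ξ i)) (t : ℕ) (s) : 0 ≤ surv ξ t s ∧ surv ξ t s ≤ 1 := by
  unfold surv
  constructor
  · exact Finset.prod_nonneg fun u _ => Finset.prod_nonneg fun i _ => sub_nonneg.2 ((hξ i _).2 _).2
  · refine Finset.prod_le_one (fun u _ => Finset.prod_nonneg fun i _ => sub_nonneg.2 ((hξ i _).2 _).2) fun u _ => ?_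
    exact Finset.prod_le_one (fun i _ => sub_nonneg.2 ((hξ i _).2 _).2) fun i _ => by
      linarith [((hξ i _).2 (fun k => s (Fin.castLE u.2 k))).1]

lemma measurable_PSξ {ξ : Fin N → SunspotStrategy} (hξ : ∀ i, ValidSunspotStrategy (ξ i)) (t : ℕ) (S) : Measurable fun s => PS (fun i => ξ i t s) S :=
  (continuous_PS S).measurable.comp (measurable_pi_iff.2 fun i => (hξ i t).1)

lemma measurable_Wξ {ξ : Fin N → SunspotStrategy} (hξ : ∀ i, ValidSunspotStrategy (ξ i)) (ρ : Finset (Fin N) → ℝ) (t : ℕ)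
    {U : (Fin (t+1) → ℝ) → ℝ} (hU : Measurable U) :
    Measurable fun s => W ρ (fun i => ξ i t s) (U s) := by
  have := fun S => measurable_PSξ hξ t S
  unfold W
  fun_prop

lemma bound_Wξ {ξ : Fin N → SunspotStrategy} (hξ : ∀ i, ValidSunspotStrategy (ξ i)) (ρ : Finset (Fin N) → ℝ) (t : ℕ)
    {U : (Fin (t+1) → ℝ) → ℝ} {B : ℝ} (hB : ∀ s, |U s| ≤ B) (s) :
    |W ρ (fun i => ξ i t s) (U s)| ≤ ∑ S ∈ nonempties N, |ρ S| + B := by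
  have hc := valid_cube hξ t s
  unfold W
  refine (abs_add_le _ _).trans (add_le_add ((Finset.abs_sum_le_sum_abs _ _).trans (Finset.sum_le_sum fun S _ => ?_)) ?_)
  · rw [abs_mul, abs_of_nonneg (PS_nonneg hc S)]
    exact mul_le_of_le_one_left (abs_nonneg _) (PS_le_one hc S)
  · rw [abs_mul, abs_of_nonneg (PS_nonneg hc _)]
    exact (mul_le_of_le_one_left (abs_nonneg _) (PS_le_one hc _)).trans (hB s)

lemma stage_eq {ξ : Fin N → SunspotStrategy} (hξ : ∀ i, ValidSunspotStrategy (ξ i)) (ρ : Finset (Fin N) → ℝ) (t : ℕ) {U : (Fin (t+1) → ℝ) → ℝ} (hU : Measurable U)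
    {B : ℝ} (hB : ∀ s, |U s| ≤ B) :
    ∑ S ∈ nonempties N, sunspotTermProb ξ t S * ρ S + ∫ s, surv ξ (t+1) s * U s ∂(signalMeasure (t+1))
     = ∫ h, surv ξ t h * ∫ u, W ρ (fun i => ξ i t (Fin.snoc h u : Fin (t+1) → ℝ))
        (U (Fin.snoc h u : Fin (t+1) → ℝ)) ∂nuU ∂(signalMeasure t) := by
  have hm := fun S => measurable_PSξ hξ t S
  have hs : Measurable fun s : Fin (t+1) → ℝ => surv ξ t (Fin.init s) :=
    (measurable_surv hξ t).comp measurable_init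
  have hB0 : 0 ≤ B := (abs_nonneg _).trans (hB 0)
  have e1 : ∫ s, surv ξ t (Fin.init s) * W ρ (fun i => ξ i t s) (U s) ∂(signalMeasure (t+1)) =
      ∑ S ∈ nonempties N, sunspotTermProb ξ t S * ρ S
        + ∫ s, surv ξ (t+1) s * U s ∂(signalMeasure (t+1)) := by
    have i1 : ∀ S, Integrable (fun s => surv ξ t (Fin.init s) * PS (fun i => ξ i t s) S * ρ S)
        (signalMeasure (t+1)) := by
      intro S
      refine integrable_bdd (B := |ρ S|) ((hs.mul (hm S)).mul_const _) fun s => ?_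
      rw [abs_mul, abs_mul, abs_of_nonneg (surv_mem hξ t _).1, abs_of_nonneg (PS_nonneg (valid_cube hξ t s) S)]
      have := mul_le_one₀ (surv_mem hξ t (Fin.init s)).2 (PS_nonneg (valid_cube hξ t s) S) (PS_le_one (valid_cube hξ t s) S)
      exact mul_le_of_le_one_left (abs_nonneg _) this
    have i2 : Integrable (fun s => surv ξ (t+1) s * U s) (signalMeasure (t+1)) := by
      refine integrable_bdd (B := B) ((measurable_surv hξ (t+1)).mul hU) fun s => ?_
      rw [abs_mul, abs_of_nonneg (surv_mem hξ _ _).1]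
      exact (mul_le_of_le_one_left (abs_nonneg _) (surv_mem hξ _ _).2).trans (hB s)
    simp only [termProb_eq, ← integral_mul_const]
    rw [← integral_finsetSum _ (fun S _ => i1 S), ← integral_add (integrable_finsetSum _ fun S _ => i1 S) i2]
    congr 1; ext s
    rw [surv_succ]
    unfold W
    rw [mul_add, Finset.mul_sum]
    congr 1
    · exact Finset.sum_congr rfl fun S _ => by ring
    · ring
  rw [← e1]
  have hWm := measurable_Wξ hξ ρ t hU
  rw [int_snoc (f := fun s => surv ξ t (Fin.init s) * W ρ (fun i => ξ i t s) (U s))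
    (hs.mul hWm) (B := ∑ S ∈ nonempties N, |ρ S| + B)]
  · simp only [Fin.init_snoc, integral_const_mul]
  · intro s
    rw [abs_mul, abs_of_nonneg (surv_mem hξ t _).1]
    exact (mul_le_of_le_one_left (abs_nonneg _) (surv_mem hξ t _).2).trans (bound_Wξ hξ ρ t hB s)

lemma stage_le {ξ : Fin N → SunspotStrategy} (hξ : ∀ i, ValidSunspotStrategy (ξ i)) (ρ : Finset (Fin N) → ℝ) (t : ℕ) {U : (Fin (t+1) → ℝ) → ℝ} (hU : Measurable U)
    {B : ℝ} (hB : ∀ s, |U s| ≤ B) {V : (Fin t → ℝ) → ℝ} (hV : Measurable V) {B' : ℝ}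
    (hB' : ∀ s, |V s| ≤ B')
    (h : ∀ h, ∫ u, W ρ (fun i => ξ i t (Fin.snoc h u : Fin (t+1) → ℝ))
        (U (Fin.snoc h u : Fin (t+1) → ℝ)) ∂nuU ≤ V h) :
    ∑ S ∈ nonempties N, sunspotTermProb ξ t S * ρ S + ∫ s, surv ξ (t+1) s * U s ∂(signalMeasure (t+1))
     ≤ ∫ h, surv ξ t h * V h ∂(signalMeasure t) := by
  rw [stage_eq hξ ρ t hU hB]
  have hi : Integrable (fun h => surv ξ t h * V h) (signalMeasure t) := by
    refine integrable_bdd (B := B') ((measurable_surv hξ t).mul hV) fun s => ?_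
    rw [abs_mul, abs_of_nonneg (surv_mem hξ _ _).1]
    exact (mul_le_of_le_one_left (abs_nonneg _) (surv_mem hξ _ _).2).trans (hB' s)
  have hWm := measurable_Wξ hξ ρ t hU
  have hWb := bound_Wξ hξ ρ t hB
  refine integral_mono ?_ hi fun s => mul_le_mul_of_nonneg_left (h s) (surv_mem hξ t s).1
  have hj : Integrable (fun p : (Fin t → ℝ) × ℝ => surv ξ t p.1 *
      W ρ (fun i => ξ i t (Fin.snoc p.1 p.2 : Fin (t+1) → ℝ))
        (U (Fin.snoc p.1 p.2 : Fin (t+1) → ℝ))) ((signalMeasure t).prod nuU) := by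
    refine integrable_bdd (B := ∑ S ∈ nonempties N, |ρ S| + B)
      (((measurable_surv hξ t).comp measurable_fst).mul (hWm.comp measurable_snoc)) fun p => ?_
    rw [abs_mul, abs_of_nonneg (surv_mem hξ t _).1]
    exact (mul_le_of_le_one_left (abs_nonneg _) (surv_mem hξ t _).2).trans (hWb _)
  have := hj.integral_prod_left
  simpa only [integral_const_mul] using this

/-- Generic upper bound on payoffs from a supermartingale certificate. -/
theorem payoff_le {ξ : Fin N → SunspotStrategy} (hξ : ∀ i, ValidSunspotStrategy (ξ i)) (ρ : Finset (Fin N) → ℝ) (U G : (t : ℕ) → (Fin t → ℝ) → ℝ)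
    (hU : ∀ t, Measurable (U t)) (hG : ∀ t, Measurable (G t)) {B : ℝ}
    (hBU : ∀ t s, |U t s| ≤ B) (hBG : ∀ t s, |G t s| ≤ B)
    {κ C : ℝ} (hκ : 0 < κ) (hκ1 : κ ≤ 1) (hC : 0 ≤ C)
    (h1 : ∀ t h, ∫ u, W ρ (fun i => ξ i t (Fin.snoc h u : Fin (t+1) → ℝ))
        (U (t+1) (Fin.snoc h u : Fin (t+1) → ℝ)) ∂nuU ≤ U t h)
    (h2 : ∀ t h, ∫ u, PS (fun i => ξ i t (Fin.snoc h u : Fin (t+1) → ℝ)) ∅ *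
        (G (t+1) (Fin.snoc h u : Fin (t+1) → ℝ)) ∂nuU ≤ (1 - κ) * G t h)
    (h3 : ∀ t s, ρ ∅ ≤ U t s + C * G t s) (u0 : ℝ) (hu0 : ∀ s, U 0 s = u0) :
    (∑' t, ∑ S ∈ nonempties N, sunspotTermProb ξ t S * ρ S) +
      (1 - ∑' t, ∑ S ∈ nonempties N, sunspotTermProb ξ t S) * ρ ∅ ≤ u0 := by
  set b : ℕ → ℝ := fun t => ∑ S ∈ nonempties N, sunspotTermProb ξ t S with hb
  set a : ℕ → ℝ := fun t => ∑ S ∈ nonempties N, sunspotTermProb ξ t S * ρ S with ha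
  have tp0 : ∀ t S, 0 ≤ sunspotTermProb ξ t S := by
    intro t S
    rw [termProb_eq]
    exact integral_nonneg fun s => mul_nonneg (surv_mem hξ _ _).1 (PS_nonneg (valid_cube hξ t s) S)
  have b0 : ∀ t, 0 ≤ b t := fun t => Finset.sum_nonneg fun S _ => tp0 t S
  have int0 : ∀ f : (Fin 0 → ℝ) → ℝ, ∫ s, surv ξ 0 s * f s ∂(signalMeasure 0) = f 0 := by
    intro f
    have : ∀ s : Fin 0 → ℝ, surv ξ 0 s * f s = f 0 := by
      intro s; rw [Subsingleton.elim s 0]; simp [surv]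
    simp [this]
  have hbs : ∀ T, ∑ t ∈ Finset.range T, b t = 1 - ∫ s, surv ξ T s ∂(signalMeasure T) := by
    intro T
    induction T with
    | zero =>
      have := int0 (fun _ => 1)
      simp at this ⊢
      linarith
    | succ T ih =>
      have hW : ∀ x : Fin N → ℝ, W (fun _ => 1) x 1 = 1 := by
        intro x
        simp only [W, mul_one, sum_PS_ne]; ring
      have := stage_eq hξ (fun _ => 1) T (U := fun _ => 1) measurable_const (B := 1) (by simp)
      simp only [hW, mul_one] at this
      simp at this
      rw [Finset.sum_range_succ, ih]
      simp only [hb]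
      linarith
  have sint : ∀ T, 0 ≤ ∫ s, surv ξ T s ∂(signalMeasure T) := fun T =>
    integral_nonneg fun s => (surv_mem hξ T s).1
  have bsum : Summable b := summable_of_sum_range_le b0 (c := 1) fun T => by
    rw [hbs]; linarith [sint T]
  have asum : Summable a := by
    refine Summable.of_norm_bounded (g := fun t => b t * ∑ S, |ρ S|) (bsum.mul_right _) fun t => ?_
    rw [Real.norm_eq_abs, ha, hb, Finset.sum_mul]
    refine (Finset.abs_sum_le_sum_abs _ _).trans (Finset.sum_le_sum fun S _ => ?_)
    rw [abs_mul, abs_of_nonneg (tp0 t S)]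
    exact mul_le_mul_of_nonneg_left
      (Finset.single_le_sum (f := fun S => |ρ S|) (fun _ _ => abs_nonneg _) (Finset.mem_univ S)) (tp0 t S)
  have k1 : ∀ T, ∑ t ∈ Finset.range T, a t + ∫ s, surv ξ T s * U T s ∂(signalMeasure T) ≤ u0 := by
    intro T
    induction T with
    | zero => rw [int0]; simp [hu0]
    | succ T ih =>
      have := stage_le hξ ρ T (hU (T+1)) (hBU (T+1)) (hU T) (hBU T) (h1 T)
      rw [Finset.sum_range_succ]
      simp only [ha] at ih ⊢
      linarith
  have k2 : ∀ T, ∫ s, surv ξ T s * G T s ∂(signalMeasure T) ≤ (1 - κ) ^ T * G 0 0 := by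
    intro T
    induction T with
    | zero => rw [int0]; simp
    | succ T ih =>
      have := stage_le hξ (fun _ => 0) T (hG (T+1)) (hBG (T+1)) ((hG T).const_mul (1 - κ))
        (B' := |1 - κ| * B)
        (fun s => by rw [abs_mul]; exact mul_le_mul_of_nonneg_left (hBG T s) (abs_nonneg _))
        (fun h => by simpa [W] using h2 T h)
      simp only [mul_zero, Finset.sum_const_zero, zero_add] at this
      refine this.trans ?_
      have e : ∀ h, surv ξ T h * ((1 - κ) * G T h) = (1 - κ) * (surv ξ T h * G T h) := fun h => by ring
      simp only [e, integral_const_mul]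
      rw [pow_succ']
      have := mul_le_mul_of_nonneg_left ih (sub_nonneg.2 hκ1)
      linarith
  have k3 : ∀ T, ∑ t ∈ Finset.range T, a t + (1 - ∑ t ∈ Finset.range T, b t) * ρ ∅
      ≤ u0 + C * ((1 - κ) ^ T * G 0 0) := by
    intro T
    have iU : Integrable (fun s => surv ξ T s * U T s) (signalMeasure T) := by
      refine integrable_bdd (B := B) ((measurable_surv hξ T).mul (hU T)) fun s => ?_
      rw [abs_mul, abs_of_nonneg (surv_mem hξ _ _).1]
      exact (mul_le_of_le_one_left (abs_nonneg _) (surv_mem hξ _ _).2).trans (hBU T s)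
    have iG : Integrable (fun s => surv ξ T s * G T s) (signalMeasure T) := by
      refine integrable_bdd (B := B) ((measurable_surv hξ T).mul (hG T)) fun s => ?_
      rw [abs_mul, abs_of_nonneg (surv_mem hξ _ _).1]
      exact (mul_le_of_le_one_left (abs_nonneg _) (surv_mem hξ _ _).2).trans (hBG T s)
    have iS : Integrable (fun s => surv ξ T s) (signalMeasure T) := by
      refine integrable_bdd (B := 1) (measurable_surv hξ T) fun s => ?_
      rw [abs_of_nonneg (surv_mem hξ _ _).1]; exact (surv_mem hξ _ _).2
    have : ∫ s, surv ξ T s * ρ ∅ ∂(signalMeasure T) ≤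
        ∫ s, (surv ξ T s * U T s + C * (surv ξ T s * G T s)) ∂(signalMeasure T) := by
      refine integral_mono (iS.mul_const _) (iU.add (iG.const_mul C)) fun s => ?_
      have := mul_le_mul_of_nonneg_left (h3 T s) (surv_mem hξ T s).1
      simp only
      linarith
    rw [integral_mul_const, integral_add iU (iG.const_mul C), integral_const_mul] at this
    rw [hbs]
    have := k1 T
    have := mul_le_mul_of_nonneg_left (k2 T) hC
    linarith
  have l1 := asum.hasSum.tendsto_sum_nat.add
    ((bsum.hasSum.tendsto_sum_nat.const_sub 1).mul_const (ρ ∅))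
  have l2 : Filter.Tendsto (fun T : ℕ => u0 + C * ((1 - κ) ^ T * G 0 0)) Filter.atTop (nhds (u0 + C * (0 * G 0 0))) :=
    ((tendsto_pow_atTop_nhds_zero_of_lt_one (by linarith) (by linarith)).mul_const _).const_mul C |>.const_add u0
  have := le_of_tendsto_of_tendsto' l1 l2 k3
  simpa using this

end

open MeasureTheory

noncomputable section

variable {N : ℕ}

lemma exists_realization {Ω : Type} [Fintype Ω] (p : Ω → ℝ) (hp : ∀ w, 0 ≤ p w)
    (hs : ∑ w, p w = 1) : ∃ o : ℝ → Ω, (@Measurable _ _ _ ⊤ o) ∧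
      ∀ f : Ω → ℝ, ∫ u, f (o u) ∂nuU = ∑ w, p w * f w := by
  classical
  let : MeasurableSpace Ω := ⊤
  have : DiscreteMeasurableSpace Ω := ⟨fun _ => trivial⟩
  have : Nonempty Ω := by
    by_contra h
    rw [not_nonempty_iff] at h
    simp at hs
  let μ : Measure Ω := ∑ w, ENNReal.ofReal (p w) • Measure.dirac w
  have hμ : ∀ w, μ {w} = ENNReal.ofReal (p w) := by
    intro w
    simp only [μ, Measure.coe_finsetSum, Finset.sum_apply, Measure.smul_apply, smul_eq_mul]
    rw [Finset.sum_eq_single w]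
    · simp
    · intro b _ hb; simp [hb]
    · simp
  have : IsProbabilityMeasure μ := by
    constructor
    simp only [μ, Measure.coe_finsetSum, Finset.sum_apply, Measure.smul_apply, smul_eq_mul, measure_univ, mul_one]
    rw [← ENNReal.ofReal_sum_of_nonneg (fun w _ => hp w), hs]; simp
  obtain ⟨f, hf, hfm⟩ := Measure.exists_measurable_map_eq μ
  refine ⟨fun u => f (Set.projIcc 0 1 zero_le_one u), hf.comp (by
    exact continuous_projIcc.measurable), fun g => ?_⟩
  have h1 := (unitInterval.measurePreserving_coe).map_eq
  have h2 : nuU = Measure.map (fun x : unitInterval => (x:ℝ)) volume := h1.symm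
  have hgm : Measurable g := measurable_from_top
  have hm2 : Measurable fun u : ℝ => f (Set.projIcc 0 1 zero_le_one u) :=
    hf.comp continuous_projIcc.measurable
  have h5 := integral_map (μ := volume) (f := fun u : ℝ => g (f (Set.projIcc 0 1 zero_le_one u)))
    (measurable_subtype_coe (p := fun x => x ∈ unitInterval)).aemeasurable
    (hgm.comp hm2).aestronglyMeasurable
  rw [h2]
  refine h5.trans ?_
  simp only [Set.projIcc_val]
  have h3 : ∫ x, g (f x) ∂volume = ∫ w, g w ∂μ := by
    rw [← hfm, integral_map hf.aemeasurable hgm.aestronglyMeasurable]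
  rw [h3, integral_fintype (Integrable.of_finite)]
  refine Finset.sum_congr rfl fun w _ => ?_
  rw [Measure.real, hμ, ENNReal.toReal_ofReal (hp w), smul_eq_mul]

/-- Finite-automaton certificates for approximate sunspot equilibria. -/
structure Auto (r : Finset (Fin N) → Fin N → ℝ) where
  K : Type
  fin : Finite K
  k0 : K
  nx : K → Option (Fin N) → K
  X : K → Option (Fin N) → Fin N → ℝ
  p : K → Option (Fin N) → ℝ
  V : K → Fin N → ℝ
  Lo : K → Fin N → ℝ
  G : K → Fin N → ℝ
  κ : ℝ
  C : ℝ
  κpos : 0 < κ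
  κle : κ ≤ 1
  Cnn : 0 ≤ C
  Xc : ∀ k o, X k o ∈ Cube N
  pnn : ∀ k o, 0 ≤ p k o
  psum : ∀ k, ∑ o, p k o = 1
  Gnn : ∀ k j, 0 ≤ G k j
  hU : ∀ k j, ∑ o, p k o * max (W (fun S => r S j) (Function.update (X k o) j 1) 0)
    (W (fun S => r S j) (Function.update (X k o) j 0) (V (nx k o) j)) ≤ V k j
  hL : ∀ k j, Lo k j ≤ ∑ o, p k o * W (fun S => r S j) (X k o) (Lo (nx k o) j)
  hG : ∀ k j, ∑ o, p k o * (PS (Function.update (X k o) j 0) ∅ * G (nx k o) j) ≤ (1 - κ) * G k j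
  tU : ∀ k j, r ∅ j ≤ V k j + C * G k j
  tL : ∀ k j, Lo k j ≤ r ∅ j + C * G k j

def Cert (r : Finset (Fin N) → Fin N → ℝ) (V Lo : Fin N → ℝ) : Prop :=
  ∃ A : Auto r, A.V A.k0 = V ∧ A.Lo A.k0 = Lo

def autoState {K O : Type} (k0 : K) (nx : K → O → K) (o : K → ℝ → O) : (t : ℕ) → (Fin t → ℝ) → K
  | 0, _ => k0
  | t+1, s => nx (autoState k0 nx o t (Fin.init s)) (o (autoState k0 nx o t (Fin.init s)) (s (Fin.last t)))

lemma PS_update_empty_le {x : Fin N → ℝ} (hx : x ∈ Cube N) (j : Fin N) {y : ℝ}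
    (hy : y ∈ Set.Icc (0:ℝ) 1) :
    PS (Function.update x j y) ∅ ≤ PS (Function.update x j 0) ∅ := by
  rw [PS_affine, PS_one_empty]
  have := PS_nonneg (Cube_update hx j (y := 0) (by simp)) ∅
  nlinarith [hy.1, hy.2]

lemma W_neg (ρ : Finset (Fin N) → ℝ) (x : Fin N → ℝ) (c : ℝ) :
    W (fun S => - ρ S) x (-c) = - W ρ x c := by
  simp only [W, mul_neg, Finset.sum_neg_distrib]; ring

theorem equilibrium_of_cert {r : Finset (Fin N) → Fin N → ℝ} {V Lo : Fin N → ℝ}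
    (h : Cert r V Lo) {ε : ℝ} (hgap : ∀ j, V j - Lo j ≤ ε) :
    ∃ ξ : Fin N → SunspotStrategy, IsSunspotEpsEquilibrium r ξ ε := by
  classical
  obtain ⟨A, hV, hLo⟩ := h
  have := A.fin
  let : MeasurableSpace A.K := ⊤
  have : DiscreteMeasurableSpace A.K := ⟨fun _ => trivial⟩
  let : MeasurableSpace (Option (Fin N)) := ⊤
  have : DiscreteMeasurableSpace (Option (Fin N)) := ⟨fun _ => trivial⟩
  choose o ho hint using fun k => exists_realization (A.p k) (A.pnn k) (A.psum k)
  have ho2 : Measurable fun q : A.K × ℝ => o q.1 q.2 :=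
    measurable_from_prod_countable_right fun k => ho k
  set st := autoState A.k0 A.nx o with hst
  have stm : ∀ t, Measurable (st t) := by
    intro t
    induction t with
    | zero => exact measurable_const
    | succ t ih =>
      have h1 : Measurable fun s : Fin (t+1) → ℝ => st t (Fin.init s) := ih.comp measurable_init
      have h2 : Measurable fun s : Fin (t+1) → ℝ => (st t (Fin.init s), s (Fin.last t)) :=
        h1.prodMk (measurable_pi_apply _)
      have h3 : Measurable fun q : A.K × Option (Fin N) => A.nx q.1 q.2 := measurable_of_countable _
      exact h3.comp (h1.prodMk (ho2.comp h2))
  let ξ : Fin N → SunspotStrategy := fun i t s =>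
    A.X (st t (Fin.init s)) (o (st t (Fin.init s)) (s (Fin.last t))) i
  have hξ : ∀ i, ValidSunspotStrategy (ξ i) := by
    intro i t
    constructor
    · have h1 : Measurable fun s : Fin (t+1) → ℝ => st t (Fin.init s) := (stm t).comp measurable_init
      have h2 : Measurable fun s : Fin (t+1) → ℝ => (st t (Fin.init s), s (Fin.last t)) :=
        h1.prodMk (measurable_pi_apply _)
      have h3 : Measurable fun q : A.K × Option (Fin N) => A.X q.1 q.2 i := measurable_of_countable _
      exact h3.comp (h1.prodMk (ho2.comp h2))
    · intro s; exact mem_Cube.1 (A.Xc _ _) i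
  obtain ⟨B, hB⟩ : ∃ B : ℝ, ∀ k j, |A.V k j| ≤ B ∧ |A.Lo k j| ≤ B ∧ |A.G k j| ≤ B := by
    have := Fintype.ofFinite A.K
    refine ⟨∑ q : A.K × Fin N, (|A.V q.1 q.2| + |A.Lo q.1 q.2| + |A.G q.1 q.2|), fun k j => ?_⟩
    have := Finset.single_le_sum (f := fun q : A.K × Fin N => |A.V q.1 q.2| + |A.Lo q.1 q.2| + |A.G q.1 q.2|)
      (fun _ _ => by positivity) (Finset.mem_univ (k, j))
    have a1 := abs_nonneg (A.V k j)
    have a2 := abs_nonneg (A.Lo k j)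
    have a3 := abs_nonneg (A.G k j)
    simp only at this
    refine ⟨?_, ?_, ?_⟩ <;> linarith
  have updE : ∀ j ξ' t s, (fun i => Function.update ξ j ξ' i t s) =
      Function.update (A.X (st t (Fin.init s)) (o (st t (Fin.init s)) (s (Fin.last t)))) j (ξ' t s) := by
    intro j ξ' t s
    ext i
    by_cases hij : i = j
    · subst hij; simp
    · simp [hij, ξ]
  have stE : ∀ t (h : Fin t → ℝ) u, st (t+1) (Fin.snoc h u : Fin (t+1) → ℝ) = A.nx (st t h) (o (st t h) u) := by
    intro t h u
    simp [hst, autoState]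
  have hξu : ∀ j ξ', ValidSunspotStrategy ξ' → ∀ i, ValidSunspotStrategy (Function.update ξ j ξ' i) := by
    intro j ξ' h' i
    by_cases hij : i = j
    · subst hij; simpa using h'
    · simpa [hij] using hξ i
  have meas_st : ∀ (f : A.K → ℝ) t, Measurable fun s => f (st t s) := fun f t =>
    (measurable_of_countable f).comp (stm t)
  have intb : ∀ (f : Option (Fin N) → ℝ) k, Integrable (fun u => f (o k u)) nuU := by
    intro f k
    refine integrable_bdd (B := ∑ w, |f w|) ((measurable_of_countable f).comp (ho k)) fun u => ?_
    exact Finset.single_le_sum (f := fun w => |f w|) (fun _ _ => abs_nonneg _) (Finset.mem_univ _)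
  have snm : ∀ t (h : Fin t → ℝ), Measurable fun u : ℝ => (Fin.snoc h u : Fin (t+1) → ℝ) :=
    fun t h => measurable_snoc.comp (measurable_const.prodMk measurable_id)
  have hGG : ∀ j ξ', ValidSunspotStrategy ξ' → ∀ t h,
      ∫ u, PS (fun i => Function.update ξ j ξ' i t (Fin.snoc h u : Fin (t+1) → ℝ)) ∅ *
        (A.G (st (t+1) (Fin.snoc h u : Fin (t+1) → ℝ)) j) ∂nuU ≤ (1 - A.κ) * A.G (st t h) j := by
    intro j ξ' h' t h
    refine le_trans ?_ (A.hG (st t h) j)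
    rw [← hint (st t h) (fun w => PS (Function.update (A.X (st t h) w) j 0) ∅ * A.G (A.nx (st t h) w) j)]
    refine integral_mono ?_ (intb (fun w => PS (Function.update (A.X (st t h) w) j 0) ∅ * A.G (A.nx (st t h) w) j) _) fun u => ?_
    · have m1 := (measurable_PSξ (hξu j ξ' h') t ∅).comp (snm t h)
      have m2 := (meas_st (fun k => A.G k j) (t+1)).comp (snm t h)
      refine integrable_bdd (B := B) (m1.mul m2) fun u => ?_
      have hc := valid_cube (hξu j ξ' h') t (Fin.snoc h u : Fin (t+1) → ℝ)
      rw [abs_mul, abs_of_nonneg (PS_nonneg hc _)]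
      exact (mul_le_of_le_one_left (abs_nonneg _) (PS_le_one hc _)).trans (hB _ _).2.2
    · simp only [updE, stE, Fin.init_snoc, Fin.snoc_last]
      exact mul_le_mul_of_nonneg_right (PS_update_empty_le (A.Xc _ _) j ((h' t).2 _)) (A.Gnn _ _)
  have up : ∀ j ξ', ValidSunspotStrategy ξ' → sunspotPayoff r (Function.update ξ j ξ') j ≤ V j := by
    intro j ξ' h'
    refine payoff_le (hξu j ξ' h') (fun S => r S j) (fun t s => A.V (st t s) j)
      (fun t s => A.G (st t s) j) (meas_st fun k => A.V k j) (meas_st fun k => A.G k j) (B := B) (fun t s => (hB _ _).1)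
      (fun t s => (hB _ _).2.2) A.κpos A.κle A.Cnn ?_ (hGG j ξ' h') (fun t s => A.tU _ _) _
      (fun s => by rw [← hV]; rfl)
    intro t h
    refine le_trans ?_ (A.hU (st t h) j)
    rw [← hint (st t h) (fun w => max (W (fun S => r S j) (Function.update (A.X (st t h) w) j 1) 0)
      (W (fun S => r S j) (Function.update (A.X (st t h) w) j 0) (A.V (A.nx (st t h) w) j)))]
    refine integral_mono ?_ (intb (fun w => max (W (fun S => r S j) (Function.update (A.X (st t h) w) j 1) 0)
      (W (fun S => r S j) (Function.update (A.X (st t h) w) j 0) (A.V (A.nx (st t h) w) j))) _) fun u => ?_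
    · exact integrable_bdd ((measurable_Wξ (hξu j ξ' h') (fun S => r S j) t
        (meas_st (fun k => A.V k j) (t+1))).comp (snm t h))
        (fun u => bound_Wξ (hξu j ξ' h') (fun S => r S j) t (U := fun s => A.V (st (t+1) s) j)
          (B := B) (fun s => (hB _ _).1) _)
    · simp only [updE, stE, Fin.init_snoc, Fin.snoc_last]
      refine W_update_le ((h' t).2 _) ?_ (le_max_right _ _)
      rw [W_one _ _ _ _ 0]; exact le_max_left _ _
  have low : ∀ j, Lo j ≤ sunspotPayoff r ξ j := by
    intro j
    have hself : Function.update ξ j (ξ j) = ξ := Function.update_eq_self _ _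
    have hg := hGG j (ξ j) (hξ j)
    rw [hself] at hg
    have := payoff_le hξ (fun S => - r S j) (fun t s => - A.Lo (st t s) j)
      (fun t s => A.G (st t s) j) (fun t => (meas_st (fun k => A.Lo k j) t).neg) (meas_st fun k => A.G k j) (B := B)
      (fun t s => by rw [abs_neg]; exact (hB _ _).2.1)
      (fun t s => (hB _ _).2.2) A.κpos A.κle A.Cnn ?_ hg (fun t s => by
        have := A.tL (st t s) j; linarith) (- Lo j)
      (fun s => by rw [← hLo]; rfl)
    · simp only [mul_neg, Finset.sum_neg_distrib, tsum_neg] at this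
      unfold sunspotPayoff
      linarith
    · intro t h
      have e := A.hL (st t h) j
      rw [← hint (st t h) (fun w => W (fun S => r S j) (A.X (st t h) w) (A.Lo (A.nx (st t h) w) j))] at e
      have : ∀ u, W (fun S => - r S j) (fun i => ξ i t (Fin.snoc h u : Fin (t+1) → ℝ))
          (- A.Lo (st (t+1) (Fin.snoc h u : Fin (t+1) → ℝ)) j) =
          - W (fun S => r S j) (A.X (st t h) (o (st t h) u)) (A.Lo (A.nx (st t h) (o (st t h) u)) j) := by
        intro u
        rw [W_neg, stE]
        simp [ξ]
      simp only [this]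
      rw [integral_neg]
      linarith
  refine ⟨ξ, hξ, fun j ξ' h' => ?_⟩
  have := up j ξ' h'
  have := low j
  have := hgap j
  linarith

end

noncomputable section

variable {N : ℕ}

lemma PS_zero {S : Finset (Fin N)} (hS : S ≠ ∅) : PS (0 : Fin N → ℝ) S = 0 := by
  obtain ⟨k, hk⟩ := Finset.nonempty_iff_ne_empty.2 hS
  unfold PS
  rw [Finset.prod_eq_zero hk (by simp), zero_mul]

lemma PS_zero_empty : PS (0 : Fin N → ℝ) ∅ = 1 := by simp [PS]

lemma W_zero (ρ : Finset (Fin N) → ℝ) (c : ℝ) : W ρ 0 c = c := by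
  unfold W
  rw [Finset.sum_eq_zero, PS_zero_empty]
  · ring
  · intro S hS
    rw [PS_zero (by simpa [nonempties] using hS), zero_mul]

lemma W_pure (ρ : Finset (Fin N) → ℝ) (i : Fin N) (c : ℝ) :
    W ρ (Function.update 0 i 1) c = ρ {i} := by
  unfold W
  rw [PS_one_empty, zero_mul, add_zero, Finset.sum_eq_single {i}]
  · unfold PS
    rw [Finset.prod_singleton, Finset.prod_eq_one]
    · simp
    · intro k hk
      have : k ≠ i := by simpa using hk
      simp [this]
  · intro S hS hne
    unfold PS
    by_cases hi : i ∈ S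
    · obtain ⟨k, hk, hki⟩ : ∃ k ∈ S, k ≠ i := by
        by_contra hcon
        push Not at hcon
        exact hne (Finset.eq_singleton_iff_unique_mem.2 ⟨hi, hcon⟩)
      rw [Finset.prod_eq_zero hk (by simp [hki])]; ring
    · rw [Finset.prod_eq_zero (s := Sᶜ) (i := i) (by simpa using hi) (by simp)]; ring
  · intro h; simp [nonempties] at h

lemma update_zero_zero (i : Fin N) : Function.update (0 : Fin N → ℝ) i 0 = 0 :=
  Function.update_eq_self i (0 : Fin N → ℝ)

lemma W_single (ρ : Finset (Fin N) → ℝ) (i : Fin N) (y c : ℝ) :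
    W ρ (Function.update 0 i y) c = y * ρ {i} + (1 - y) * c := by
  rw [W_affine, W_pure, update_zero_zero, W_zero]

lemma PS_single_empty (i : Fin N) (y : ℝ) :
    PS (Function.update (0 : Fin N → ℝ) i y) ∅ = 1 - y := by
  rw [PS_affine, PS_one_empty, update_zero_zero, PS_zero_empty]; ring

lemma single_cube (i : Fin N) {y : ℝ} (hy : 0 ≤ y) (hy1 : y ≤ 1) :
    Function.update (0 : Fin N → ℝ) i y ∈ Cube N :=
  Cube_update (mem_Cube.2 fun _ => by simp) i ⟨hy, hy1⟩

lemma W_le_one {ρ : Finset (Fin N) → ℝ} (hρ : ∀ S, |ρ S| ≤ 1) {x : Fin N → ℝ} (hx : x ∈ Cube N)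
    {c : ℝ} (hc : c ≤ 1) : W ρ x c ≤ 1 := by
  have h1 := (abs_le.1 (abs_W_ne_le hρ hx)).2
  have h2 := PS_nonneg hx ∅
  unfold W
  nlinarith

/-- Quitting against a single player quitting with probability `η`. -/
lemma W_quit_le {r : Finset (Fin N) → Fin N → ℝ} (hr : ∀ S i, |r S i| ≤ 1)
    (hdiag : ∀ i, r {i} i = 0) (i j : Fin N) {η : ℝ} (h0 : 0 ≤ η) (h1 : η ≤ 1) (c : ℝ) :
    W (fun S => r S j) (Function.update (Function.update 0 i η) j 1) c ≤ η := by
  by_cases hij : i = j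
  · subst hij
    rw [Function.update_idem, W_pure, hdiag]; exact h0
  · have e0 : Function.update (Function.update (0 : Fin N → ℝ) j 1) i 0 = Function.update (0 : Fin N → ℝ) j 1 := by
      rw [Function.update_comm (Ne.symm hij), update_zero_zero]
    have e1 := W_one (fun S => r S j) (Function.update (0 : Fin N → ℝ) j 1) i c 0
    rw [Function.update_comm hij, W_affine, e1, e0, W_pure, hdiag]
    have := W_le_one (fun S => hr S j) (x := Function.update (Function.update 0 j 1) i 1)
      (Cube_update (single_cube j zero_le_one le_rfl) i ⟨zero_le_one, le_rfl⟩) (c := 0) zero_le_one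
    nlinarith

lemma W_cont (ρ : Finset (Fin N) → ℝ) (i j : Fin N) (η c : ℝ) :
    W ρ (Function.update (Function.update 0 i η) j 0) c =
      if i = j then c else η * ρ {i} + (1 - η) * c := by
  split_ifs with hij
  · subst hij
    rw [Function.update_idem, update_zero_zero, W_zero]
  · rw [Function.update_comm hij, update_zero_zero, W_single]

theorem Cert.extend {r : Finset (Fin N) → Fin N → ℝ} (hdiag : ∀ i, r {i} i = 0)
    {V' Lo' : Fin N → ℝ} (h : Cert r V' Lo') (p : Option (Fin N) → ℝ) (X : Fin N → Fin N → ℝ)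
    (V Lo : Fin N → ℝ) (hp : ∀ o, 0 ≤ p o) (hs : p none + ∑ i, p (some i) = 1) (hp0 : 0 < p none)
    (hX : ∀ i, X i ∈ Cube N)
    (hU : ∀ j, p none * max 0 (V' j) + ∑ i, p (some i) *
      max (W (fun S => r S j) (Function.update (X i) j 1) 0)
        (W (fun S => r S j) (Function.update (X i) j 0) (V j)) ≤ V j)
    (hL : ∀ j, Lo j ≤ p none * Lo' j + ∑ i, p (some i) * W (fun S => r S j) (X i) (Lo j)) :
    Cert r V Lo := by
  obtain ⟨A, rfl, rfl⟩ := h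
  have := A.fin
  have hκ := A.κpos
  have hp1 : p none ≤ 1 := by
    have := Finset.sum_nonneg fun i (_ : i ∈ Finset.univ) => hp (some i)
    linarith
  set Cn : ℝ := A.C + ∑ j, (|r ∅ j| + |V j| + |Lo j|) with hCn
  have hC1 : A.C ≤ Cn := by
    have : 0 ≤ ∑ j, (|r ∅ j| + |V j| + |Lo j|) := Finset.sum_nonneg fun j _ => by positivity
    linarith
  have hC2 : ∀ j, |r ∅ j| + |V j| + |Lo j| ≤ Cn := fun j => by
    have := Finset.single_le_sum (f := fun j => |r ∅ j| + |V j| + |Lo j|) (fun _ _ => by positivity) (Finset.mem_univ j)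
    have := A.Cnn
    rw [hCn]
    linarith
  have hCn0 : 0 ≤ Cn := A.Cnn.trans hC1
  let nx : Option A.K → Option (Fin N) → Option A.K := fun k o => match k, o with
    | none, none => some A.k0
    | none, some _ => none
    | some k, o => some (A.nx k o)
  let Xn : Option A.K → Option (Fin N) → Fin N → ℝ := fun k o => match k, o with
    | none, none => 0
    | none, some i => X i
    | some k, o => A.X k o
  let pn : Option A.K → Option (Fin N) → ℝ := fun k o => match k with
    | none => p o
    | some k => A.p k o
  let Vn : Option A.K → Fin N → ℝ := fun k => match k with
    | none => V
    | some k => A.V k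
  let Ln : Option A.K → Fin N → ℝ := fun k => match k with
    | none => Lo
    | some k => A.Lo k
  let Gn : Option A.K → Fin N → ℝ := fun k j => match k with
    | none => 2 * (A.G A.k0 j + 1)
    | some k => A.G k j
  refine ⟨{
    K := Option A.K
    fin := inferInstance
    k0 := none
    nx := nx
    X := Xn
    p := pn
    V := Vn
    Lo := Ln
    G := Gn
    κ := min A.κ (p none / 2)
    C := Cn
    κpos := lt_min hκ (by linarith)
    κle := (min_le_left _ _).trans A.κle
    Cnn := hCn0
    Xc := ?_
    pnn := ?_
    psum := ?_
    Gnn := ?_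
    hU := ?_
    hL := ?_
    hG := ?_
    tU := ?_
    tL := ?_ }, rfl, rfl⟩
  · rintro (_ | k) (_ | o)
    · exact mem_Cube.2 fun _ => by simp [Xn]
    · exact hX o
    · exact A.Xc k _
    · exact A.Xc k _
  · rintro (_ | k) o
    · exact hp o
    · exact A.pnn k o
  · rintro (_ | k)
    · rw [Fintype.sum_option]; exact hs
    · exact A.psum k
  · rintro (_ | k) j
    · have := A.Gnn A.k0 j
      simp only [Gn]; linarith
    · exact A.Gnn k j
  · rintro (_ | k) j
    · rw [Fintype.sum_option]
      refine le_trans (le_of_eq ?_) (hU j)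
      simp only [pn, Xn, nx, Vn]
      rw [W_pure, update_zero_zero, W_zero, hdiag]
    · exact A.hU k j
  · rintro (_ | k) j
    · rw [Fintype.sum_option]
      refine le_trans (hL j) (le_of_eq ?_)
      simp only [pn, Xn, nx, Ln]
      rw [W_zero]
    · exact A.hL k j
  · rintro (_ | k) j
    · rw [Fintype.sum_option]
      simp only [pn, Xn, nx, Gn]
      rw [update_zero_zero, PS_zero_empty]
      have hg := A.Gnn A.k0 j
      have h1 : ∑ i, p (some i) * (PS (Function.update (X i) j 0) ∅ * (2 * (A.G A.k0 j + 1))) ≤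
          ∑ i, p (some i) * (2 * (A.G A.k0 j + 1)) := by
        refine Finset.sum_le_sum fun i _ => mul_le_mul_of_nonneg_left ?_ (hp _)
        exact mul_le_of_le_one_left (by linarith) (PS_le_one (Cube_update (hX i) j (by simp)) _)
      rw [← Finset.sum_mul] at h1
      have h2 := min_le_right A.κ (p none / 2)
      have h3 : ∑ i, p (some i) = 1 - p none := by linarith
      rw [h3] at h1
      have h4 := mul_le_mul_of_nonneg_right h2 (show 0 ≤ 2 * (A.G A.k0 j + 1) by linarith)
      nlinarith
    · refine (A.hG k j).trans (mul_le_mul_of_nonneg_right ?_ (A.Gnn k j))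
      linarith [min_le_left A.κ (p none / 2)]
  · rintro (_ | k) j
    · have hg := A.Gnn A.k0 j
      have := hC2 j
      have a1 := le_abs_self (r ∅ j)
      have a2 := neg_abs_le (V j)
      have a3 := abs_nonneg (Lo j)
      have := mul_le_mul_of_nonneg_left (show (1:ℝ) ≤ 2 * (A.G A.k0 j + 1) by linarith) hCn0
      simp only [Vn, Gn]
      linarith
    · have := mul_le_mul_of_nonneg_right hC1 (A.Gnn k j)
      have := A.tU k j
      simp only [Vn, Gn]; linarith
  · rintro (_ | k) j
    · have hg := A.Gnn A.k0 j
      have := hC2 j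
      have a1 := neg_abs_le (r ∅ j)
      have a2 := le_abs_self (Lo j)
      have a3 := abs_nonneg (V j)
      have := mul_le_mul_of_nonneg_left (show (1:ℝ) ≤ 2 * (A.G A.k0 j + 1) by linarith) hCn0
      simp only [Ln, Gn]
      linarith
    · have := mul_le_mul_of_nonneg_right hC1 (A.Gnn k j)
      have := A.tL k j
      simp only [Ln, Gn]; linarith

/-- One-state automata with a constant mixed action. -/
theorem Cert.const {r : Finset (Fin N) → Fin N → ℝ} (x : Fin N → ℝ) (hx : x ∈ Cube N)
    (V Lo G : Fin N → ℝ) (κ C : ℝ) (hκ : 0 < κ) (hκ1 : κ ≤ 1) (hC : 0 ≤ C) (hG : ∀ j, 0 ≤ G j)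
    (h1 : ∀ j, W (fun S => r S j) (Function.update x j 1) 0 ≤ V j)
    (h0 : ∀ j, W (fun S => r S j) (Function.update x j 0) (V j) ≤ V j)
    (hL : ∀ j, Lo j ≤ W (fun S => r S j) x (Lo j))
    (hG' : ∀ j, PS (Function.update x j 0) ∅ * G j ≤ (1 - κ) * G j)
    (tU : ∀ j, r ∅ j ≤ V j + C * G j) (tL : ∀ j, Lo j ≤ r ∅ j + C * G j) : Cert r V Lo := by
  refine ⟨{
    K := Unit
    fin := inferInstance
    k0 := ()
    nx := fun _ _ => ()
    X := fun _ _ => x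
    p := fun _ o => if o = none then 1 else 0
    V := fun _ => V
    Lo := fun _ => Lo
    G := fun _ => G
    κ := κ
    C := C
    κpos := hκ
    κle := hκ1
    Cnn := hC
    Xc := fun _ _ => hx
    pnn := fun _ o => by split_ifs <;> norm_num
    psum := fun _ => by simp
    Gnn := fun _ => hG
    hU := fun _ j => by simpa using ⟨h1 j, h0 j⟩
    hL := fun _ j => by simpa using hL j
    hG := fun _ j => by simpa using hG' j
    tU := fun _ => tU
    tL := fun _ => tL }, rfl, rfl⟩

/-- never quitting -/
theorem cert_never {r : Finset (Fin N) → Fin N → ℝ} (hdiag : ∀ i, r {i} i = 0)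
    (h : ∀ j, 0 ≤ r ∅ j) : Cert r (r ∅) (r ∅) := by
  refine Cert.const 0 (mem_Cube.2 fun _ => by simp) _ _ 0 1 0 one_pos le_rfl le_rfl (fun _ => le_rfl)
    (fun j => ?_) (fun j => ?_) (fun j => ?_) (fun j => by simp) (fun j => by simp) (fun j => by simp)
  · rw [W_pure, hdiag]; exact h j
  · rw [update_zero_zero, W_zero]
  · rw [W_zero]

/-- punishing player `i0` -/
theorem cert_punish {r : Finset (Fin N) → Fin N → ℝ} (hr : ∀ S i, |r S i| ≤ 1)
    (hdiag : ∀ i, r {i} i = 0) (i0 : Fin N) (h : r ∅ i0 ≤ 0 ∨ ∃ k, k ≠ i0 ∧ r {k} i0 ≤ 0)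
    {η : ℝ} (hη : 0 < η) (hη1 : η ≤ 1 / 3) (V Lo : Fin N → ℝ) (hV0 : V i0 = 3 * η)
    (hV : ∀ j, j ≠ i0 → 1 ≤ V j) (hLo : ∀ j, Lo j ≤ -1) : Cert r V Lo := by
  classical
  have hVnn : ∀ j, 3 * η ≤ V j := fun j => by
    by_cases hj : j = i0
    · subst hj; exact hV0.ge
    · linarith [hV j hj]
  rcases h with h | ⟨k, hk, h⟩
  · refine Cert.const 0 (mem_Cube.2 fun _ => by simp) _ _ 0 1 0 one_pos le_rfl le_rfl (fun _ => le_rfl)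
      (fun j => ?_) (fun j => ?_) (fun j => ?_) (fun j => by simp) (fun j => ?_) (fun j => ?_)
    · rw [W_pure, hdiag]; linarith [hVnn j]
    · rw [update_zero_zero, W_zero]
    · rw [W_zero]
    · by_cases hj : j = i0
      · subst hj; simp; linarith
      · simp; linarith [hV j hj, (abs_le.1 (hr ∅ j)).2]
    · simp; linarith [hLo j, (abs_le.1 (hr ∅ j)).1]
  · refine Cert.const (Function.update 0 k η) (single_cube k hη.le (by linarith)) _ _
      (fun j => if j = i0 then 1 else 0) η 2 hη (by linarith) (by norm_num) (fun j => ?_)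
      (fun j => ?_) (fun j => ?_) (fun j => ?_) (fun j => ?_) (fun j => ?_) (fun j => ?_)
    · split_ifs <;> norm_num
    · linarith [W_quit_le hr hdiag k j hη.le (by linarith) 0, hVnn j]
    · rw [W_cont]
      split_ifs with hkj
      · exact le_rfl
      · have := hVnn j
        by_cases hj : j = i0
        · subst hj; nlinarith
        · have := hV j hj
          have := (abs_le.1 (hr {k} j)).2
          nlinarith
    · rw [W_single]
      have := hLo j
      have := (abs_le.1 (hr {k} j)).1
      nlinarith
    · by_cases hj : j = i0
      · subst hj
        rw [Function.update_comm hk, update_zero_zero, PS_single_empty]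
      · simp [hj]
    · have := (abs_le.1 (hr ∅ j)).2
      by_cases hj : j = i0
      · subst hj; simp; linarith [hVnn j]
      · simp [hj]; linarith [hV j hj]
    · have := (abs_le.1 (hr ∅ j)).1
      have := hLo j
      split_ifs <;> linarith

end

noncomputable section

variable {N : ℕ}

theorem Cert.step {r : Finset (Fin N) → Fin N → ℝ} (hr : ∀ S i, |r S i| ≤ 1)
    (hdiag : ∀ i, r {i} i = 0) {V' Lo' : Fin N → ℝ} (h : Cert r V' Lo') (V Lo z : Fin N → ℝ)
    {η a : ℝ} (hη : 0 < η) (hη1 : η ≤ 1 / 3) (ha : 0 < a) (hz : ∀ i, 0 ≤ z i) (hs : 0 < ∑ i, z i)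
    (hV' : ∀ j, 0 ≤ V' j) (hV : ∀ j, 3 * η ≤ V j)
    (hu : ∀ j, a * V' j + mulR (fun i j => r {i} j) z j + z j * V j ≤ (a + ∑ i, z i) * V j)
    (hl : ∀ j, (a + ∑ i, z i) * Lo j ≤ a * Lo' j + mulR (fun i j => r {i} j) z j) :
    Cert r V Lo := by
  classical
  set s := ∑ i, z i with hsdef
  have hD : 0 < η * a + s := by positivity
  refine Cert.extend hdiag h (fun o => match o with
    | none => η * a / (η * a + s)
    | some i => z i / (η * a + s)) (fun i => Function.update 0 i η) V Lo ?_ ?_ ?_ ?_ ?_ ?_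
  · rintro (_ | i)
    · simp only; positivity
    · simp only; exact div_nonneg (hz i) hD.le
  · simp only
    rw [← Finset.sum_div, ← hsdef, ← add_div, div_self hD.ne']
  · simp only; positivity
  · intro i; exact single_cube i hη.le (by linarith)
  · intro j
    simp only
    have key : ∀ i, max (W (fun S => r S j) (Function.update (Function.update 0 i η) j 1) 0)
        (W (fun S => r S j) (Function.update (Function.update 0 i η) j 0) (V j)) ≤
        (η * r {i} j + (1 - η) * V j) + if i = j then η * V j else 0 := by
      intro i
      have hVj := hV j
      refine max_le ((W_quit_le hr hdiag i j hη.le (by linarith) 0).trans ?_) ?_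
      · have := (abs_le.1 (hr {i} j)).1
        by_cases hij : i = j
        · subst hij; rw [hdiag]; simp; nlinarith
        · simp only [hij, if_false, add_zero]
          nlinarith
      · rw [W_cont]
        by_cases hij : i = j
        · subst hij; rw [hdiag]; simp; nlinarith
        · simp [hij]
    have e : ∑ i, z i / (η * a + s) *
        ((η * r {i} j + (1 - η) * V j) + if i = j then η * V j else 0) =
        (η * mulR (fun i j => r {i} j) z j + (1 - η) * V j * s + η * (z j * V j)) / (η * a + s) := by
      rw [mulR, hsdef, Finset.mul_sum, Finset.mul_sum]
      have : η * (z j * V j) = ∑ i, if i = j then η * (z i * V j) else 0 := by simp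
      rw [this, ← Finset.sum_add_distrib, ← Finset.sum_add_distrib, Finset.sum_div]
      refine Finset.sum_congr rfl fun i _ => ?_
      split_ifs <;> ring
    have h1 : ∑ i, z i / (η * a + s) *
        max (W (fun S => r S j) (Function.update (Function.update 0 i η) j 1) 0)
        (W (fun S => r S j) (Function.update (Function.update 0 i η) j 0) (V j)) ≤ _ :=
      (Finset.sum_le_sum fun i _ => mul_le_mul_of_nonneg_left (key i) (div_nonneg (hz i) hD.le)).trans_eq e
    rw [max_eq_right (hV' j)]
    refine (add_le_add le_rfl h1).trans ?_
    rw [div_mul_eq_mul_div, ← add_div, div_le_iff₀ hD]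
    have := mul_le_mul_of_nonneg_left (hu j) hη.le
    nlinarith
  · intro j
    simp only [W_single]
    have e : ∑ i, z i / (η * a + s) * (η * r {i} j + (1 - η) * Lo j) =
        (η * mulR (fun i j => r {i} j) z j + (1 - η) * Lo j * s) / (η * a + s) := by
      rw [mulR, hsdef, Finset.mul_sum, Finset.mul_sum, ← Finset.sum_add_distrib, Finset.sum_div]
      refine Finset.sum_congr rfl fun i _ => ?_
      ring
    rw [e, div_mul_eq_mul_div, ← add_div, le_div_iff₀ hD]
    have := mul_le_mul_of_nonneg_left (hl j) hη.le
    nlinarith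

/-- Case (a): certificates along a reachable path. -/
theorem cert_reach {r : Finset (Fin N) → Fin N → ℝ} (hr : ∀ S i, |r S i| ≤ 1)
    (hdiag : ∀ i, r {i} i = 0) {J : Finset (Fin N)}
    (hJ : ∀ j, j ∉ J → ∀ k, k ≠ j → 0 < r {k} j)
    (hJ' : ∀ i ∈ J, r ∅ i ≤ 0 ∨ ∃ k, k ≠ i ∧ r {k} i ≤ 0)
    {v0 : Fin N → ℝ} {i0 : Fin N} (hi0 : i0 ∈ J) (hv0 : v0 i0 = 0) (hv1 : ∀ j, j ≠ i0 → 1 ≤ v0 j)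
    {B : ℝ} (hB : ∀ j, v0 j ≤ B) {η : ℝ} (hη : 0 < η) (hη1 : η ≤ 1 / 3)
    {v : Fin N → ℝ} {m e : ℝ} (h : Reach (fun i j => r {i} j) J v0 v m e) :
    Cert r (fun j => v j / (1 + m) + 3 * η + e) (fun j => v j / (1 + m) - e - (B + 1) / (1 + m)) := by
  have hne : Nonempty (Fin N) := ⟨i0⟩
  have v0nn : ∀ j, 0 ≤ v0 j := fun j => by
    by_cases hj : j = i0
    · subst hj; exact hv0.ge
    · linarith [hv1 j hj]
  have inv : ∀ {v : Fin N → ℝ} {m e : ℝ}, Reach (fun i j => r {i} j) J v0 v m e →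
      ∀ j, - e ≤ v j / (1 + m) := by
    intro v m e h j
    have hm := h.mass_nonneg
    have he := h.err_nonneg
    have : - e ≤ v j := by
      by_cases hj : j ∈ J
      · linarith [(h.bdry (fun j _ => v0nn j) ⟨i0, hi0, hv0⟩).1 j hj]
      · obtain ⟨z, z1, z2, z3, z4⟩ := h.total
        have := (abs_le.1 (z4 j)).1
        have : 0 ≤ mulR (fun i j => r {i} j) z j := by
          refine Finset.sum_nonneg fun i _ => ?_
          by_cases hi : i ∈ J
          · exact mul_nonneg (z1 i) (hJ j hj i (fun h => hj (h ▸ hi))).le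
          · rw [z2 i hi, zero_mul]
        linarith [v0nn j]
    rw [le_div_iff₀ (by linarith)]
    nlinarith
  induction h with
  | refl =>
    refine cert_punish hr hdiag i0 (hJ' i0 hi0) hη hη1 _ _ ?_ ?_ ?_
    · simp [hv0]
    · intro j hj; have := hv1 j hj; simp; linarith
    · intro j; have := hB j; simp; linarith
  | @step v m e h q z δ hq hz hpos ih =>
    have hm := h.mass_nonneg
    have he := h.err_nonneg
    have hδ : 0 ≤ δ := (abs_nonneg _).trans (hq i0)
    have inv' := inv h
    have inv2 := inv (Reach.step h q z δ hq hz hpos)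
    have hm1 : (0:ℝ) < 1 + m := by linarith
    have hm2 : 0 < 1 + (m + ∑ i, z i) := by linarith
    refine Cert.step hr hdiag ih _ _ z hη hη1 hm1 hz.nonneg hpos ?_ ?_ ?_ ?_
    · intro j; linarith [inv' j]
    · intro j; linarith [inv2 j]
    · intro j
      set vp := q j + mulR (fun i j => r {i} j) z j with hvp
      have hz0 := hz.nonneg j
      have hzs : z j ≤ ∑ i, z i := Finset.single_le_sum (f := z) (fun i _ => hz.nonneg i) (Finset.mem_univ j)
      have hzv : z j * vp = 0 := by
        by_cases hj : j ∈ J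
        · exact hz.compl j hj
        · rw [hz.supp j hj, zero_mul]
      have e1 : (1 + m) * (v j / (1 + m)) = v j := mul_div_cancel₀ _ hm1.ne'
      have e2 : (1 + m + ∑ i, z i) * (vp / (1 + (m + ∑ i, z i))) = vp := by
        rw [add_assoc]; exact mul_div_cancel₀ _ hm2.ne'
      have e3 : z j * (vp / (1 + (m + ∑ i, z i))) = 0 := by
        rw [← mul_div_assoc, hzv, zero_div]
      have hqj := (abs_le.1 (hq j)).1
      have k1 : z j * (3 * η + (e + δ)) ≤ (∑ i, z i) * (3 * η + (e + δ)) :=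
        mul_le_mul_of_nonneg_right hzs (by linarith)
      have k2 : 0 ≤ m * δ := mul_nonneg hm hδ
      calc (1 + m) * (v j / (1 + m) + 3 * η + e) + mulR (fun i j => r {i} j) z j
            + z j * (vp / (1 + (m + ∑ i, z i)) + 3 * η + (e + δ))
          = (1 + m) * (v j / (1 + m)) + (1 + m) * (3 * η + e) + mulR (fun i j => r {i} j) z j
            + (z j * (vp / (1 + (m + ∑ i, z i))) + z j * (3 * η + (e + δ))) := by ring
        _ ≤ (1 + m + ∑ i, z i) * (vp / (1 + (m + ∑ i, z i))) + (1 + m) * (3 * η + (e + δ)) +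
            (∑ i, z i) * (3 * η + (e + δ)) := by
            rw [e1, e2, e3]; linarith
        _ = _ := by ring
    · intro j
      set vp := q j + mulR (fun i j => r {i} j) z j with hvp
      have e1 : (1 + m) * (v j / (1 + m)) = v j := mul_div_cancel₀ _ hm1.ne'
      have e2 : (1 + m + ∑ i, z i) * (vp / (1 + (m + ∑ i, z i))) = vp := by
        rw [add_assoc]; exact mul_div_cancel₀ _ hm2.ne'
      have e3 : (1 + m) * ((B + 1) / (1 + m)) = B + 1 := mul_div_cancel₀ _ hm1.ne'
      have e4 : (1 + m + ∑ i, z i) * ((B + 1) / (1 + (m + ∑ i, z i))) = B + 1 := by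
        rw [add_assoc]; exact mul_div_cancel₀ _ hm2.ne'
      have hqj := (abs_le.1 (hq j)).2
      have k2 : 0 ≤ m * δ := mul_nonneg hm hδ
      have k3 : 0 ≤ (∑ i, z i) * (e + δ) := mul_nonneg hpos.le (by linarith)
      simp only [mul_sub]
      rw [e1, e2, e3, e4]
      linarith

/-- Case (b): homogeneous solution. -/
theorem cert_homog {r : Finset (Fin N) → Fin N → ℝ} (hr : ∀ S i, |r S i| ≤ 1)
    (hdiag : ∀ i, r {i} i = 0) {J : Finset (Fin N)}
    (hJ : ∀ j, j ∉ J → ∀ k, k ≠ j → 0 < r {k} j)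
    (hJ' : ∀ i ∈ J, r ∅ i ≤ 0 ∨ ∃ k, k ≠ i ∧ r {k} i ≤ 0)
    {z : Fin N → ℝ} (hz : LCPsol (fun i j => r {i} j) J (fun _ => 0) z) (hpos : 0 < ∑ i, z i)
    {η : ℝ} (hη : 0 < η) (hη1 : η ≤ 1 / 3) :
    ∃ w : Fin N → ℝ, Cert r (fun j => w j + 3 * η) (fun j => w j - 6 * η) := by
  obtain ⟨z, hz, hsum⟩ : ∃ z, LCPsol (fun i j => r {i} j) J (fun _ => 0) z ∧ ∑ i, z i = 1 := by
    have := hz.scale (t := (∑ i, z i)⁻¹) (by positivity)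
    simp only [mul_zero] at this
    exact ⟨_, this, by rw [← Finset.mul_sum, inv_mul_cancel₀ hpos.ne']⟩
  obtain ⟨i0, hi0⟩ : ∃ i0, 0 < z i0 := by
    by_contra hcon
    push Not at hcon
    have := Finset.sum_nonpos fun i (_ : i ∈ Finset.univ) => hcon i
    linarith
  have hi0J : i0 ∈ J := by
    by_contra hcon
    linarith [hz.supp i0 hcon]
  set w : Fin N → ℝ := fun j => mulR (fun i j => r {i} j) z j with hw
  have hw1 : ∀ j, w j ≤ 1 := fun j => by
    have := (abs_le.1 (abs_mulR_le (R := fun i j => r {i} j) (fun i j => hr _ _) hz.nonneg j)).2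
    linarith
  have hw0 : ∀ j, 0 ≤ w j := by
    intro j
    by_cases hj : j ∈ J
    · simpa using hz.feas j hj
    · refine Finset.sum_nonneg fun i _ => ?_
      by_cases hi : i ∈ J
      · exact mul_nonneg (hz.nonneg i) (hJ j hj i (fun h => hj (h ▸ hi))).le
      · rw [hz.supp i hi, zero_mul]
  have hzw : ∀ j, z j * w j = 0 := by
    intro j
    by_cases hj : j ∈ J
    · simpa using hz.compl j hj
    · rw [hz.supp j hj, zero_mul]
  have hwi : w i0 = 0 := by
    rcases mul_eq_zero.1 (hzw i0) with h | h
    · linarith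
    · exact h
  have hz1 : z i0 ≤ 1 := by
    rw [← hsum]; exact Finset.single_le_sum (f := z) (fun i _ => hz.nonneg i) (Finset.mem_univ i0)
  refine ⟨w, ?_⟩
  have base : Cert r (fun j => if j = i0 then 3 * η else w j + 1 + 3 * η) (fun _ => -1) := by
    refine cert_punish hr hdiag i0 (hJ' i0 hi0J) hη hη1 _ _ (by simp) (fun j hj => ?_) (fun _ => le_rfl)
    have := hw0 j
    simp [hj]; linarith
  refine Cert.step hr hdiag base _ _ z hη hη1 (a := 3 * η * z i0) (by positivity) hz.nonneg
    (by rw [hsum]; exact one_pos) (fun j => ?_) (fun j => by linarith [hw0 j]) (fun j => ?_) (fun j => ?_)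
  · have := hw0 j
    split_ifs <;> linarith
  · rw [hsum]
    change _ + w j + _ ≤ _
    have := hzw j
    by_cases hj : j = i0
    · subst hj
      simp only [if_true, hwi]
      nlinarith
    · simp only [hj, if_false]
      have h2 : z i0 + z j ≤ 1 := by
        rw [← hsum, ← Finset.sum_pair (f := z) (Ne.symm hj)]
        exact Finset.sum_le_sum_of_subset_of_nonneg (Finset.subset_univ _) fun i _ _ => hz.nonneg i
      have h3 : z j * (w j + 3 * η) = 3 * η * z j := by rw [mul_add, this]; ring
      rw [h3]
      nlinarith
  · rw [hsum]
    change _ ≤ _ + w j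
    have h1 := hw1 j
    have h2 := hw0 j
    have h4 : 0 < 3 * η * z i0 := by positivity
    have h5 : 3 * η * z i0 ≤ 3 * η := by nlinarith
    nlinarith

/-- Case (c1): stationary profile with two quitters. -/
theorem cert_stat {r : Finset (Fin N) → Fin N → ℝ} {x γ : Fin N → ℝ} (hx : x ∈ Cube N)
    (hγ : ∀ j, W (fun S => r S j) x (γ j) = γ j ∧ W (fun S => r S j) (Function.update x j 1) 0 ≤ γ j ∧
      W (fun S => r S j) (Function.update x j 0) (γ j) ≤ γ j)
    (hns : ∀ j, ∃ k, k ≠ j ∧ x k ≠ 0) : Cert r γ γ := by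
  have hx' := mem_Cube.1 hx
  have hc : ∀ j, Function.update x j 0 ∈ Cube N := fun j => Cube_update hx j (by simp)
  have hlt : ∀ j, PS (Function.update x j 0) ∅ < 1 := by
    intro j
    obtain ⟨k, hk, hxk⟩ := hns j
    have hk0 : 0 < x k := lt_of_le_of_ne (hx' k).1 (Ne.symm hxk)
    have := mem_Cube.1 (hc j)
    rw [PS_empty, ← Finset.mul_prod_erase _ _ (Finset.mem_univ k)]
    have h1 : ∏ i ∈ Finset.univ.erase k, (1 - Function.update x j 0 i) ≤ 1 :=
      Finset.prod_le_one (fun i _ => by linarith [(this i).2]) fun i _ => by linarith [(this i).1]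
    have h2 : 0 ≤ ∏ i ∈ Finset.univ.erase k, (1 - Function.update x j 0 i) :=
      Finset.prod_nonneg fun i _ => by linarith [(this i).2]
    have h3 : Function.update x j 0 k = x k := by simp [hk]
    rw [h3]
    have := (hx' k).2
    nlinarith
  have hnn : ∀ j, 0 ≤ 1 - PS (Function.update x j 0) ∅ := fun j => by linarith [hlt j]
  have hle : ∀ j, 1 - PS (Function.update x j 0) ∅ ≤ 1 := fun j => by linarith [PS_nonneg (hc j) ∅]
  have hC : ∀ j, |r ∅ j| + |γ j| ≤ ∑ j, (|r ∅ j| + |γ j|) := fun j =>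
    Finset.single_le_sum (f := fun j => |r ∅ j| + |γ j|) (fun _ _ => by positivity) (Finset.mem_univ j)
  refine Cert.const x hx γ γ (fun _ => 1) (∏ j, (1 - PS (Function.update x j 0) ∅))
    (∑ j, (|r ∅ j| + |γ j|)) ?_ ?_ ?_ (fun _ => zero_le_one) (fun j => (hγ j).2.1) (fun j => (hγ j).2.2)
    (fun j => (hγ j).1.ge) ?_ ?_ ?_
  · exact Finset.prod_pos fun j _ => by linarith [hlt j]
  · exact Finset.prod_le_one (fun j _ => hnn j) fun j _ => hle j
  · exact Finset.sum_nonneg fun _ _ => by positivity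
  · intro j
    have : ∏ j, (1 - PS (Function.update x j 0) ∅) ≤ 1 - PS (Function.update x j 0) ∅ := by
      rw [← Finset.mul_prod_erase _ _ (Finset.mem_univ j)]
      exact mul_le_of_le_one_right (hnn j) (Finset.prod_le_one (fun j _ => hnn j) fun j _ => hle j)
    linarith
  · intro j
    have := hC j
    have := le_abs_self (r ∅ j)
    have := neg_abs_le (γ j)
    linarith
  · intro j
    have := hC j
    have := neg_abs_le (r ∅ j)
    have := le_abs_self (γ j)
    linarith

/-- Case (c2): sole quitter. -/
theorem cert_sole {r : Finset (Fin N) → Fin N → ℝ} (hr : ∀ S i, |r S i| ≤ 1)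
    (hdiag : ∀ i, r {i} i = 0) {i : Fin N} (hi : r ∅ i ≤ 0 ∨ ∃ k, k ≠ i ∧ r {k} i ≤ 0)
    {y : ℝ} (hy : 0 < y) (hy1 : y ≤ 1)
    (hq : ∀ j, W (fun S => r S j) (Function.update (Function.update 0 i y) j 1) 0 ≤ r {i} j)
    {η : ℝ} (hη : 0 < η) (hη1 : η ≤ 1 / 3) :
    Cert r (fun j => r {i} j + 3 * η) (fun j => r {i} j - 3 * η) := by
  classical
  have base : Cert r (fun j => if j = i then 3 * η else 2) (fun _ => -1) := by
    refine cert_punish hr hdiag i hi hη hη1 _ _ (by simp) (fun j hj => ?_) (fun _ => le_rfl)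
    simp [hj]
  set τ : ℝ := y * η / 2 with hτ
  have hyη : 0 < y * η := mul_pos hy hη
  have hyη1 : y * η ≤ 1 / 3 := by nlinarith
  have hτ0 : 0 < τ := by positivity
  have hτ1 : τ ≤ 1 / 2 := by linarith
  refine Cert.extend hdiag base (fun o => match o with
    | none => τ
    | some k => if k = i then 1 - τ else 0) (fun _ => Function.update 0 i y) _ _ ?_ ?_ hτ0
    (fun _ => single_cube i hy.le hy1) ?_ ?_
  · rintro (_ | k)
    · exact hτ0.le
    · simp only; split_ifs <;> linarith
  · simp
  · intro j
    simp only [ite_mul, zero_mul, Finset.sum_ite_eq', Finset.mem_univ, if_true]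
    have hqj := hq j
    rw [W_cont]
    by_cases hj : j = i
    · subst hj
      rw [hdiag] at hqj ⊢
      simp only [if_true, zero_add]
      rw [max_eq_right (by linarith), max_eq_right (by linarith)]
      linarith
    · have hw := (abs_le.1 (hr {i} j)).1
      simp only [hj, Ne.symm hj, if_false]
      have hmx : max (W (fun S => r S j) (Function.update (Function.update 0 i y) j 1) 0)
          (y * r {i} j + (1 - y) * (r {i} j + 3 * η)) ≤ r {i} j + (1 - y) * (3 * η) := by
        refine max_le (hqj.trans ?_) (by linarith)
        have : 0 ≤ (1 - y) * (3 * η) := mul_nonneg (by linarith) (by linarith)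
        linarith
      have := mul_le_mul_of_nonneg_left hmx (show 0 ≤ 1 - τ by linarith)
      rw [max_eq_right (by norm_num)]
      refine (add_le_add le_rfl this).trans ?_
      have h1 : (1 - τ) * (y * η) ≥ 1 / 2 * (y * η) := mul_le_mul_of_nonneg_right (by linarith) hyη.le
      have h2 : 0 ≤ τ * η := by positivity
      have h3 : τ * r {i} j ≥ τ * (-1) := mul_le_mul_of_nonneg_left hw hτ0.le
      nlinarith
  · intro j
    simp only [ite_mul, zero_mul, Finset.sum_ite_eq', Finset.mem_univ, if_true, W_single]
    have hw := (abs_le.1 (hr {i} j)).2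
    have h3 : τ * r {i} j ≤ τ * 1 := mul_le_mul_of_nonneg_left hw hτ0.le
    have h4 : 0 ≤ τ * η * (1 - y) := mul_nonneg (by positivity) (by linarith)
    nlinarith

theorem main_cert (hN : 1 ≤ N) (r : Finset (Fin N) → Fin N → ℝ) (hr : ∀ S i, |r S i| ≤ 1)
    (hdiag : ∀ i, r {i} i = 0) {ε : ℝ} (hε : 0 < ε) :
    ∃ V Lo, Cert r V Lo ∧ ∀ j, V j - Lo j ≤ ε := by
  classical
  have hne : Nonempty (Fin N) := ⟨⟨0, hN⟩⟩
  obtain ⟨η, hη, hη1, hηε⟩ : ∃ η : ℝ, 0 < η ∧ η ≤ 1 / 3 ∧ 9 * η ≤ ε :=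
    ⟨min (1/3) (ε/9), by positivity, min_le_left _ _, by linarith [min_le_right (1/3) (ε/9)]⟩
  set J : Finset (Fin N) := Finset.univ.filter fun i => r ∅ i ≤ 0 ∨ ∃ k, k ≠ i ∧ r {k} i ≤ 0 with hJdef
  have hJ' : ∀ i ∈ J, r ∅ i ≤ 0 ∨ ∃ k, k ≠ i ∧ r {k} i ≤ 0 := fun i hi => by simpa [hJdef] using hi
  have hJc : ∀ j, j ∉ J → 0 < r ∅ j ∧ ∀ k, k ≠ j → 0 < r {k} j := fun j hj => by
    simpa [hJdef] using hj
  have hJ : ∀ j, j ∉ J → ∀ k, k ≠ j → 0 < r {k} j := fun j hj => (hJc j hj).2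
  by_cases hJe : J.Nonempty
  swap
  · rw [Finset.not_nonempty_iff_eq_empty] at hJe
    refine ⟨_, _, cert_never hdiag fun j => (hJc j (by simp [hJe])).1.le, fun j => by linarith⟩
  have caseb : ∀ z, LCPsol (fun i j => r {i} j) J (fun _ => 0) z → 0 < ∑ i, z i →
      ∃ V Lo, Cert r V Lo ∧ ∀ j, V j - Lo j ≤ ε := by
    intro z hz hpos
    obtain ⟨w, hw⟩ := cert_homog hr hdiag hJ hJ' hz hpos hη hη1
    exact ⟨_, _, hw, fun j => by linarith⟩
  by_cases hQ : IsQ (fun i j => r {i} j) J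
  · rcases GG_of_IsQ (R := fun i j => r {i} j) (fun i j => hr _ _) hdiag J hJe hQ with ⟨z, hz, hpos⟩ | ⟨v0, ⟨i0, hi0, hv0, hv1⟩, h⟩
    · exact caseb z hz hpos
    · obtain ⟨B, hB0, hB⟩ : ∃ B : ℝ, 0 ≤ B ∧ ∀ j, v0 j ≤ B :=
        ⟨∑ j, |v0 j|, Finset.sum_nonneg fun _ _ => abs_nonneg _, fun j => (le_abs_self _).trans
          (Finset.single_le_sum (f := fun j => |v0 j|) (fun _ _ => abs_nonneg _) (Finset.mem_univ j))⟩
      obtain ⟨v, m, e, hre, hM, he⟩ := h ((B + 1) / η) (by positivity) η hη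
      refine ⟨_, _, cert_reach hr hdiag hJ hJ' hi0 hv0 hv1 hB hη hη1 hre, fun j => ?_⟩
      have hm := hre.mass_nonneg
      have : (B + 1) / (1 + m) ≤ η := by
        rw [div_le_iff₀ hη] at hM
        rw [div_le_iff₀ (by linarith)]
        nlinarith
      linarith
  · rcases nonQ_cases r hr hdiag J hJ hQ with ⟨z, hz, hpos⟩ | ⟨x, hx, hx0, γ, hγ, hsole⟩
    · exact caseb z hz hpos
    · by_cases hns : ∀ j, ∃ k, k ≠ j ∧ x k ≠ 0
      · exact ⟨_, _, cert_stat hx hγ hns, fun j => by linarith⟩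
      · push Not at hns
        obtain ⟨i, hi⟩ := hns
        have hxe : x = Function.update (0 : Fin N → ℝ) i (x i) := by
          ext k
          by_cases hk : k = i
          · subst hk; simp
          · simp [hk, hi k hk]
        have hxi : 0 < x i := by
          refine lt_of_le_of_ne (mem_Cube.1 hx i).1 fun h => hx0 ?_
          rw [hxe, ← h, update_zero_zero]
        have hγe : ∀ j, γ j = r {i} j := by
          intro j
          have := (hγ j).1
          rw [hxe, W_single] at this
          have h2 : x i * (r {i} j - γ j) = 0 := by linarith
          rcases mul_eq_zero.1 h2 with h | h <;> linarith
        refine ⟨_, _, cert_sole hr hdiag (hJ' i (hsole i hi)) hxi (mem_Cube.1 hx i).2 (fun j => ?_) hη hη1,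
          fun j => by linarith⟩
        rw [← hxe, ← hγe]; exact (hγ j).2.1

end

/-- **Every quitting game admits a sunspot `ε`-equilibrium, for every `ε > 0`.** -/
theorem quitting_game_sunspot_equilibrium (N : ℕ) (hN : 1 ≤ N)
    (r : Finset (Fin N) → Fin N → ℝ)
    (hr : ∀ S i, r S i ∈ Set.Icc (-1 : ℝ) 1)
    (hdiag : ∀ i : Fin N, r {i} i = 0)
    (ε : ℝ) (hε : 0 < ε) :
    ∃ ξ : Fin N → SunspotStrategy, IsSunspotEpsEquilibrium r ξ ε := by
  obtain ⟨V, Lo, h, hgap⟩ := main_cert hN r (fun S i => abs_le.2 (hr S i)) hdiag hε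
  exact equilibrium_of_cert h hgap

end
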